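/- Let V be a separable real Banach space with dual V*, and let X and X_n, n ∈ ℕ, be V-valued stochastically continuous stochastic processes on [0,T] with càdlàg trajectories. Then the following are equivalent: (a) X_n → X weakly in M₁ in probability, i.e. for every v* ∈ V* and every ε > 0, P( d_M(⟨X_n, v*⟩, ⟨X, v*⟩) ≥ ε ) → 0 as n → ∞; (b) for every v* ∈ V* both of the following hold: (i) for every t ∈ [0,T], ⟨X_n(t), v*⟩ → ⟨X(t), v*⟩ in probability, and (ii) for every ε > 0, lim_{δ ↘ 0} limsup_{n → ∞} P( M(⟨X_n, v*⟩; δ) ≥ ε ) = 0. -/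

import Mathlib

noncomputable section

open Filter Set Topology

/-- Distance from `v` to the segment joining `v₁` and `v₂`:
`M(v₁, v, v₂) = inf_{α ∈ [0,1]} ‖v − (α v₁ + (1 − α) v₂)‖`. -/
def segDist {V : Type*} [NormedAddCommGroup V] [NormedSpace ℝ V]
    (v₁ v v₂ : V) : ℝ :=
  sInf {d : ℝ | ∃ α ∈ Set.Icc (0:ℝ) 1, d = ‖v - (α • v₁ + (1 - α) • v₂)‖}

/-- Left limit `f(t−)` of `f` at `t` for the interval starting at `a`, with `f(a−) := f(a)`. -/
def leftLimIn {V : Type*} [NormedAddCommGroup V] (f : ℝ → V) (a t : ℝ) : V :=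
  if a < t then Function.leftLim f t else f a

/-- `f` is càdlàg on `[a,b]`: right-continuous at every `t ∈ [a,b)` and
having a left limit at every `t ∈ (a,b]`. -/
def IsCadlagOn {V : Type*} [NormedAddCommGroup V] (f : ℝ → V) (a b : ℝ) : Prop :=
  (∀ t ∈ Set.Ico a b, Filter.Tendsto f (nhdsWithin t (Set.Ioc t b)) (nhds (f t))) ∧
  (∀ t ∈ Set.Ioc a b, ∃ l, Filter.Tendsto f (nhdsWithin t (Set.Ico a t)) (nhds l))

/-- The extended graph `Γ(f)` of `f` on `[a,b]`. -/
def extGraph {V : Type*} [NormedAddCommGroup V] [NormedSpace ℝ V]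
    (f : ℝ → V) (a b : ℝ) : Set (ℝ × V) :=
  {p | p.1 ∈ Set.Icc a b ∧ ∃ α ∈ Set.Icc (0:ℝ) 1,
      p.2 = α • leftLimIn f a p.1 + (1 - α) • f p.1}

/-- The total order on the extended graph of `f`. -/
def graphLE {V : Type*} [NormedAddCommGroup V] (f : ℝ → V) (a : ℝ) (p q : ℝ × V) : Prop :=
  p.1 < q.1 ∨ (p.1 = q.1 ∧ ‖leftLimIn f a p.1 - p.2‖ ≤ ‖leftLimIn f a p.1 - q.2‖)

/-- `(r, u)` is a parametric representation of the extended graph of `f` on `[a,b]`: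
a continuous nondecreasing surjection of `[0,1]` onto `Γ(f)` with the correct endpoints. -/
structure IsParamRep {V : Type*} [NormedAddCommGroup V] [NormedSpace ℝ V]
    (f : ℝ → V) (a b : ℝ) (r : ℝ → ℝ) (u : ℝ → V) : Prop where
  contOn : ContinuousOn (fun s => (r s, u s)) (Set.Icc 0 1)
  mem : ∀ s ∈ Set.Icc (0:ℝ) 1, (r s, u s) ∈ extGraph f a b
  surj : ∀ p ∈ extGraph f a b, ∃ s ∈ Set.Icc (0:ℝ) 1, (r s, u s) = p
  mono : ∀ s₁ ∈ Set.Icc (0:ℝ) 1, ∀ s₂ ∈ Set.Icc (0:ℝ) 1,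
      s₁ ≤ s₂ → graphLE f a (r s₁, u s₁) (r s₂, u s₂)
  init : r 0 = a ∧ u 0 = f a
  last : r 1 = b ∧ u 1 = f b

/-- The strong `M₁` Skorokhod metric on `D([a,b];V)`. -/
def dM {V : Type*} [NormedAddCommGroup V] [NormedSpace ℝ V]
    (a b : ℝ) (f₁ f₂ : ℝ → V) : ℝ :=
  sInf {d : ℝ | ∃ r₁ u₁ r₂ u₂, IsParamRep f₁ a b r₁ u₁ ∧ IsParamRep f₂ a b r₂ u₂ ∧
    d = max (⨆ s : Set.Icc (0:ℝ) 1, |r₁ s.1 - r₂ s.1|)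
            (⨆ s : Set.Icc (0:ℝ) 1, ‖u₁ s.1 - u₂ s.1‖)}

/-- The oscillation function `M(f; δ)` on `[a,b]`. -/
def oscM {V : Type*} [NormedAddCommGroup V] [NormedSpace ℝ V]
    (f : ℝ → V) (a b δ : ℝ) : ℝ :=
  sSup {d : ℝ | ∃ t₁ t t₂ : ℝ, a ≤ t₁ ∧ t₁ < t ∧ t < t₂ ∧ t₂ ≤ b ∧ t₂ - t₁ ≤ δ ∧
    d = segDist (f t₁) (f t) (f t₂)}

end

section RealPaths

open Filter Set Topology

/-- `F` is right-continuous on the whole line, and its left limit at `t` is `L t`. -/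
structure HasCadlagLimits (F L : ℝ → ℝ) : Prop where
  right : ∀ t, Tendsto F (𝓝[>] t) (𝓝 (F t))
  left : ∀ t, Tendsto F (𝓝[<] t) (𝓝 (L t))

namespace HasCadlagLimits

variable {F L : ℝ → ℝ}

lemma neg (h : HasCadlagLimits F L) :
    HasCadlagLimits (fun t => -F t) (fun t => -L t) :=
  ⟨fun t => (h.right t).neg, fun t => (h.left t).neg⟩

lemma leftLim_mem (h : HasCadlagLimits F L) {S : Set ℝ} (hS : IsClosed S) {a b : ℝ}
    (hF : ∀ x ∈ Ioo a b, F x ∈ S) : ∀ x ∈ Ioo a b, L x ∈ S := by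
  intro x hx
  refine hS.mem_of_tendsto (h.left x) ?_
  filter_upwards [Ioo_mem_nhdsLT hx.1] with y hy
  exact hF y ⟨hy.1, hy.2.trans hx.2⟩

lemma near_right (h : HasCadlagLimits F L) (t : ℝ) {ε : ℝ} (hε : 0 < ε) :
    ∃ b > t, ∀ x ∈ Ioo t b,
      F x ∈ Icc (F t - ε) (F t + ε) ∧ L x ∈ Icc (F t - ε) (F t + ε) := by
  have h1 : ∀ᶠ x in 𝓝[>] t, F x ∈ Icc (F t - ε) (F t + ε) :=
    (h.right t) (Icc_mem_nhds (by linarith) (by linarith))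
  obtain ⟨b, hb, hb'⟩ := mem_nhdsGT_iff_exists_Ioo_subset.1 h1
  exact ⟨b, hb, fun x hx => ⟨hb' hx, h.leftLim_mem isClosed_Icc (fun y hy => hb' hy) x hx⟩⟩

lemma near_left (h : HasCadlagLimits F L) (t : ℝ) {ε : ℝ} (hε : 0 < ε) :
    ∃ a < t, ∀ x ∈ Ioo a t,
      F x ∈ Icc (L t - ε) (L t + ε) ∧ L x ∈ Icc (L t - ε) (L t + ε) := by
  have h1 : ∀ᶠ x in 𝓝[<] t, F x ∈ Icc (L t - ε) (L t + ε) :=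
    (h.left t) (Icc_mem_nhds (by linarith) (by linarith))
  obtain ⟨b, hb, hb'⟩ := mem_nhdsLT_iff_exists_Ioo_subset.1 h1
  exact ⟨b, hb, fun x hx => ⟨hb' hx, h.leftLim_mem isClosed_Icc (fun y hy => hb' hy) x hx⟩⟩

lemma countable_jumps (h : HasCadlagLimits F L) : {t | L t ≠ F t}.Countable := by
  refine Countable.mono ?_ (countable_iUnion fun a : ℚ =>
    (countable_image_gt_image_Iio_within (Ioi (a : ℝ)) F).union
      (countable_image_lt_image_Iio_within (Ioi (a : ℝ)) F))
  intro t ht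
  rcases lt_or_gt_of_ne (show L t ≠ F t from ht) with hlt | hlt
  · obtain ⟨a, ha, hF⟩ := h.near_left t (half_pos (sub_pos.2 hlt))
    obtain ⟨q, hq, hq'⟩ := exists_rat_btwn ha
    refine mem_iUnion.2 ⟨q, ?_⟩
    exact Or.inr ⟨hq', L t + (F t - L t) / 2, by linarith, fun y hy hyt =>
      (hF y ⟨hq.trans hy, hyt⟩).1.2⟩
  · obtain ⟨a, ha, hF⟩ := h.near_left t (half_pos (sub_pos.2 hlt))
    obtain ⟨q, hq, hq'⟩ := exists_rat_btwn ha
    refine mem_iUnion.2 ⟨q, ?_⟩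
    exact Or.inl ⟨hq', L t - (L t - F t) / 2, by linarith, fun y hy hyt =>
      (hF y ⟨hq.trans hy, hyt⟩).1.1⟩

end HasCadlagLimits

/-- A time change which opens an interval `[φm t, φp t]` at every point `t` of a countable set. -/
lemma exists_time_stretch {J : Set ℝ} (hJ : J.Countable) :
    ∃ φm φp r : ℝ → ℝ, (∀ t, φm t ≤ φp t) ∧ (∀ t ∈ J, φm t < φp t) ∧
      (∀ t t', t < t' → φp t + (t' - t) ≤ φm t') ∧
      (∀ s, φm (r s) ≤ s ∧ s ≤ φp (r s)) := by
  classical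
  obtain ⟨w, hw, c, hc, -⟩ := hJ.exists_pos_hasSum_le one_pos
  have hsum : ∀ p : ℝ → Prop, Summable fun i : J => if p i then w i else 0 := fun p =>
    Summable.of_nonneg_of_le (fun i => by split_ifs <;> simp [(hw i).le])
      (fun i => by split_ifs <;> simp [(hw i).le]) hc.summable
  set S : (ℝ → Prop) → ℝ := fun p => ∑' i : J, if p i then w i else 0 with hS
  have hmono : ∀ p q : ℝ → Prop, (∀ i, p i → q i) →
      S p ≤ S q := by
    refine fun p q hpq => (hsum p).tsum_le_tsum (fun i => ?_) (hsum q)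
    have := hw i
    have := hpq i
    split_ifs <;> simp_all [le_of_lt]
  have hbd : ∀ p : ℝ → Prop, S p ≤ c := by
    intro p
    refine (hmono p (fun _ => True) (by simp)).trans ?_
    simp [hS, hc.tsum_eq]
  have hnn : ∀ p : ℝ → Prop, 0 ≤ S p :=
    fun p => tsum_nonneg fun i => by split_ifs <;> simp [(hw i).le]
  have htend : ∀ (l : Filter ℝ) (p : ℝ → ℝ → Prop) (q : ℝ → Prop),
      (∀ i, ∀ᶠ t in l, (p t i ↔ q i)) →
      Tendsto (fun t => S (p t)) l
        (𝓝 (S q)) := by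
    intro l p q hpq
    refine tendsto_tsum_of_dominated_convergence hc.summable (fun k => ?_)
      (Eventually.of_forall fun t i => ?_)
    · refine tendsto_const_nhds.congr' ?_
      filter_upwards [hpq k] with t ht
      simp [ht]
    · have := hw i
      split_ifs <;> simp [abs_of_pos, this, this.le]
  set φm : ℝ → ℝ := fun t => t + S (· < t) with hφm
  set φp : ℝ → ℝ := fun t => t + S (· ≤ t) with hφp
  have h2 : ∀ t t', t < t' → φp t + (t' - t) ≤ φm t' := by
    intro t t' h
    have := hmono (fun i => i ≤ t) (fun i => i < t') (fun i hi => lt_of_le_of_lt hi h)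
    simp only [hφm, hφp]
    linarith
  have hleft : ∀ t, Tendsto φm (𝓝[<] t) (𝓝 (φm t)) := by
    intro t
    refine (tendsto_id.mono_left nhdsWithin_le_nhds).add (htend _ (fun t i => i < t) (· < t) ?_)
    intro i
    rcases lt_or_ge i t with h | h
    · filter_upwards [Ioo_mem_nhdsLT h] with y hy
      simp [h, hy.1]
    · filter_upwards [self_mem_nhdsWithin] with y (hy : y < t)
      simp [h.not_gt, (hy.le.trans h)]
  have hright : ∀ t, Tendsto φm (𝓝[>] t) (𝓝 (φp t)) := by
    intro t
    refine (tendsto_id.mono_left nhdsWithin_le_nhds).add (htend _ (fun t i => i < t) (· ≤ t) ?_)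
    intro i
    rcases le_or_gt i t with h | h
    · filter_upwards [self_mem_nhdsWithin] with y (hy : t < y)
      simp [h, h.trans_lt hy]
    · filter_upwards [Ioo_mem_nhdsGT h] with y hy
      simp [h.not_ge, hy.2.le]
  have hr : ∀ s, ∃ t, φm t ≤ s ∧ s ≤ φp t := by
    intro s
    set A := {t | φm t ≤ s}
    have hb : BddAbove A := ⟨s, fun t (ht : φm t ≤ s) => by
      have := hnn (fun i => i < t)
      simp only [hφm] at ht
      linarith⟩
    have hne : A.Nonempty := ⟨s - c, by
      have := hbd (fun i => i < s - c)
      change φm (s - c) ≤ s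
      simp only [hφm]
      linarith⟩
    refine ⟨sSup A, ?_, ?_⟩
    · by_contra! hlt
      obtain ⟨a, ha, hab⟩ := mem_nhdsLT_iff_exists_Ioo_subset.1
        ((hleft (sSup A)).eventually (lt_mem_nhds hlt))
      obtain ⟨t, ht, hat⟩ := exists_lt_of_lt_csSup hne ha
      rcases (le_csSup hb ht).eq_or_lt with h | h
      · rw [← h] at hlt
        exact absurd (show φm t ≤ s from ht) hlt.not_ge
      · exact absurd (show φm t ≤ s from ht) (not_le.2 (hab ⟨hat, h⟩))
    · by_contra! hlt
      obtain ⟨t, ht, hst⟩ := (((hright (sSup A)).eventually (gt_mem_nhds hlt)).and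
        self_mem_nhdsWithin).exists
      exact absurd (le_csSup hb (show t ∈ A from ht.le)) (not_le.2 hst)
  choose r hr using hr
  refine ⟨φm, φp, r, ?_, ?_, h2, hr⟩
  · intro t
    have := hmono (fun i => i < t) (fun i => i ≤ t) (fun i => le_of_lt)
    simp only [hφm, hφp]
    linarith
  · intro t ht
    have : S (· < t) < S (· ≤ t) := by
      refine Summable.tsum_lt_tsum (i := ⟨t, ht⟩) (fun i => ?_) ?_ (hsum (· < t)) (hsum (· ≤ t))
      · have := hw i
        have := le_of_lt (a := (i : ℝ)) (b := t)
        split_ifs <;> simp_all [le_of_lt]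
      · simp [hw]
    simp only [hφm, hφp]
    linarith

/-- Every completed graph of a càdlàg function is the trace of a monotone continuous path; the
interval `[φm t, φp t]` is mapped onto the segment of the graph above `t`. -/
lemma HasCadlagLimits.exists_graph_path {F L : ℝ → ℝ} (h : HasCadlagLimits F L) :
    ∃ r u φm φp : ℝ → ℝ, Continuous r ∧ Continuous u ∧ Monotone r ∧
      (∀ s, ∃ α ∈ Icc (0 : ℝ) 1, u s = α * L (r s) + (1 - α) * F (r s)) ∧
      (∀ t, ∀ α ∈ Icc (0 : ℝ) 1, ∃ s ∈ Icc (φm t) (φp t),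
        r s = t ∧ u s = α * L t + (1 - α) * F t) ∧
      (∀ s s', s ≤ s' → r s = r s' → |L (r s) - u s| ≤ |L (r s) - u s'|) ∧
      (∀ t, r (φm t) = t ∧ u (φm t) = L t ∧ r (φp t) = t ∧ u (φp t) = F t) ∧
      (∀ t, φm t ≤ φp t) ∧ (∀ t t', t < t' → φp t < φm t') := by
  obtain ⟨φm, φp, r, hle, hJ, hgap, hr⟩ := exists_time_stretch h.countable_jumps
  have hlt : ∀ t t', t < t' → φp t < φm t' := fun t t' htt => by
    linarith [hgap t t' htt]
  have huniq : ∀ s t, φm t ≤ s → s ≤ φp t → r s = t := by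
    intro s t h1 h2
    rcases lt_trichotomy (r s) t with h3 | h3 | h3
    · linarith [hlt _ _ h3, (hr s).2]
    · exact h3
    · linarith [hlt _ _ h3, (hr s).1]
  have hmono : Monotone r := by
    intro s s' hs
    by_contra! h3
    linarith [hlt _ _ h3, (hr s).1, (hr s').2]
  have hgt : ∀ s t, φp t < s → t < r s := by
    intro s t hs
    by_contra! h3
    rcases h3.eq_or_lt with h3 | h3
    · have := (hr s).2
      rw [h3] at this
      linarith
    · linarith [hlt _ _ h3, (hr s).2, hle t]
  have hls : ∀ s t, s < φm t → r s < t := by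
    intro s t hs
    by_contra! h3
    rcases h3.eq_or_lt with h3 | h3
    · have := (hr s).1
      rw [← h3] at this
      linarith
    · linarith [hlt _ _ h3, (hr s).1, hle t]
  have hlip : ∀ s s', s ≤ s' → r s' - r s ≤ s' - s := by
    intro s s' hs
    rcases (hmono hs).eq_or_lt with h1 | h1
    · linarith
    · linarith [hgap _ _ h1, (hr s).2, (hr s').1]
  have hcont : Continuous r := by
    refine LipschitzWith.continuous (K := 1) (LipschitzWith.of_le_add fun s s' => ?_)
    rw [Real.dist_eq]
    rcases le_total s s' with h1 | h1
    · linarith [hmono h1, abs_nonneg (s - s')]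
    · linarith [hlip _ _ h1, le_abs_self (s - s')]
  set θ : ℝ → ℝ := fun s => (φp (r s) - s) / (φp (r s) - φm (r s)) with hθ
  have hθ01 : ∀ s, θ s ∈ Icc (0 : ℝ) 1 := fun s =>
    ⟨div_nonneg (by linarith [(hr s).2]) (by linarith [hle (r s)]),
      div_le_one_of_le₀ (by linarith [(hr s).1]) (by linarith [hle (r s)])⟩
  set u : ℝ → ℝ := fun s => θ s * L (r s) + (1 - θ s) * F (r s) with hu
  have huIcc : ∀ s a b, L (r s) ∈ Icc a b → F (r s) ∈ Icc a b → u s ∈ Icc a b := by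
    intro s a b h1 h2
    have := convex_Icc a b h1 h2 (hθ01 s).1 (sub_nonneg.2 (hθ01 s).2) (by ring)
    simpa [hu] using this
  have hum : ∀ t, u (φm t) = L t := by
    intro t
    have hrt := huniq (φm t) t le_rfl (hle t)
    simp only [hu, hθ, hrt]
    by_cases hj : L t = F t
    · rw [hj]; ring
    · rw [div_self (sub_ne_zero.2 (hJ t hj).ne')]; ring
  have hup : ∀ t, u (φp t) = F t := by
    intro t
    have hrt := huniq (φp t) t (hle t) le_rfl
    simp [hu, hθ, hrt]
  refine ⟨r, u, φm, φp, hcont, ?_, hmono, fun s => ⟨θ s, hθ01 s, rfl⟩, ?_, ?_,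
    fun t => ⟨huniq _ _ le_rfl (hle t), hum t, huniq _ _ (hle t) le_rfl, hup t⟩, hle, hlt⟩
  · rw [continuous_iff_continuousAt]
    intro s₀
    set t := r s₀ with ht
    have haff : ContinuousOn u (Icc (φm t) (φp t)) := by
      refine ContinuousOn.congr (f := fun s => (φp t - s) / (φp t - φm t) * L t +
        (1 - (φp t - s) / (φp t - φm t)) * F t) (by fun_prop) ?_
      intro s hs
      simp only [hu, hθ, huniq s t hs.1 hs.2]
    refine continuousAt_iff_continuous_left_right.2 ⟨?_, ?_⟩
    · rcases (hr s₀).1.lt_or_eq with h1 | h1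
      · exact (haff s₀ (hr s₀)).mono_of_mem_nhdsWithin
          (mem_of_superset (Icc_mem_nhdsLE h1) (Icc_subset_Icc_right (hr s₀).2))
      · rw [← continuousWithinAt_Iio_iff_Iic, ContinuousWithinAt, ← h1, hum,
          Metric.tendsto_nhds]
        intro ε hε
        obtain ⟨a, ha, hF⟩ := h.near_left t (half_pos hε)
        filter_upwards [Ioo_mem_nhdsLT (hlt a t ha)] with s hs
        have hrs : r s ∈ Ioo a t := ⟨hgt _ _ hs.1, hls _ _ hs.2⟩
        have := huIcc s _ _ (hF _ hrs).2 (hF _ hrs).1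
        rw [Real.dist_eq, abs_lt]
        constructor <;> linarith [this.1, this.2]
    · rcases (hr s₀).2.lt_or_eq with h1 | h1
      · exact (haff s₀ (hr s₀)).mono_of_mem_nhdsWithin
          (mem_of_superset (Icc_mem_nhdsGE h1) (Icc_subset_Icc_left (hr s₀).1))
      · rw [← continuousWithinAt_Ioi_iff_Ici, ContinuousWithinAt, h1, hup,
          Metric.tendsto_nhds]
        intro ε hε
        obtain ⟨b, hb, hF⟩ := h.near_right t (half_pos hε)
        filter_upwards [Ioo_mem_nhdsGT (hlt t b hb)] with s hs
        have hrs : r s ∈ Ioo t b := ⟨hgt _ _ hs.1, hls _ _ hs.2⟩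
        have := huIcc s _ _ (hF _ hrs).2 (hF _ hrs).1
        rw [Real.dist_eq, abs_lt]
        constructor <;> linarith [this.1, this.2]
  · intro t α hα
    have hd : 0 ≤ φp t - φm t := sub_nonneg.2 (hle t)
    have h1 : φm t ≤ α * φm t + (1 - α) * φp t := by nlinarith [hα.2]
    have h2 : α * φm t + (1 - α) * φp t ≤ φp t := by nlinarith [hα.1]
    refine ⟨α * φm t + (1 - α) * φp t, ⟨h1, h2⟩, huniq _ _ h1 h2, ?_⟩
    simp only [hu, hθ, huniq _ _ h1 h2]
    by_cases hj : L t = F t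
    · rw [hj]; ring
    · have : φp t - φm t ≠ 0 := sub_ne_zero.2 (hJ t hj).ne'
      have : (φp t - (α * φm t + (1 - α) * φp t)) / (φp t - φm t) = α := by
        field_simp; ring
      rw [this]
  · intro s s' hs hrs
    have e : ∀ x, L (r x) - u x = (1 - θ x) * (L (r x) - F (r x)) := fun x => by
      simp only [hu]; ring
    rw [e s]
    conv_rhs => rw [hrs, e s']
    rw [abs_mul, abs_mul, hrs]
    refine mul_le_mul_of_nonneg_right ?_ (abs_nonneg _)
    rw [abs_of_nonneg (sub_nonneg.2 (hθ01 s).2), abs_of_nonneg (sub_nonneg.2 (hθ01 s').2)]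
    have : θ s' ≤ θ s := by
      simp only [hθ, hrs]
      exact div_le_div_of_nonneg_right (by linarith) (sub_nonneg.2 (hle _))
    linarith

/-- `F` extends `f : [0,T] → ℝ` to the line by constants, and `L` is its left limit. -/
structure IsCadlagExtension (T : ℝ) (f F L : ℝ → ℝ) : Prop where
  cadlag : HasCadlagLimits F L
  eqOn : ∀ t ∈ Icc 0 T, F t = f t
  leftLim_eq : ∀ t ∈ Icc 0 T, leftLimIn f 0 t = L t
  clamp : ∀ t, F t = F (max 0 (min t T))

lemma IsCadlagOn.exists_extension {T : ℝ} (hT : 0 < T) {f : ℝ → ℝ} (hf : IsCadlagOn f 0 T) :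
    ∃ L, IsCadlagExtension T f (fun t => f (max 0 (min t T))) L := by
  set F : ℝ → ℝ := fun t => f (max 0 (min t T)) with hF
  have hF0 : ∀ t ≤ 0, F t = f 0 := fun t ht => by
    simp [hF, ht, ht.trans hT.le]
  have hFT : ∀ t ≥ T, F t = f T := fun t ht => by
    simp [hF, ht, hT.le]
  have hFI : ∀ t ∈ Icc 0 T, F t = f t := fun t ht => by
    simp [hF, ht.1, ht.2]
  have hright : ∀ t, Tendsto F (𝓝[>] t) (𝓝 (F t)) := by
    intro t
    rcases lt_or_ge t 0 with h | h
    · rw [hF0 t h.le]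
      refine tendsto_const_nhds.congr' ?_
      filter_upwards [Ioo_mem_nhdsGT h] with x hx
      exact (hF0 x hx.2.le).symm
    rcases lt_or_ge t T with h' | h'
    · rw [hFI t ⟨h, h'.le⟩]
      have := hf.1 t ⟨h, h'⟩
      rw [nhdsWithin_Ioc_eq_nhdsGT h'] at this
      refine this.congr' ?_
      filter_upwards [Ioo_mem_nhdsGT h'] with x hx
      exact (hFI x ⟨h.trans hx.1.le, hx.2.le⟩).symm
    · rw [hFT t h']
      refine tendsto_const_nhds.congr' ?_
      filter_upwards [self_mem_nhdsWithin] with x (hx : t < x)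
      exact (hFT x (h'.trans hx.le)).symm
  have hleft : ∀ t, ∃ l, Tendsto F (𝓝[<] t) (𝓝 l) ∧ (t ∈ Icc 0 T → leftLimIn f 0 t = l) := by
    intro t
    rcases le_or_gt t 0 with h | h
    · refine ⟨f 0, ?_, fun h0 => ?_⟩
      · refine tendsto_const_nhds.congr' ?_
        filter_upwards [self_mem_nhdsWithin] with x (hx : x < t)
        exact (hF0 x (hx.le.trans h)).symm
      · simp [leftLimIn, h.not_gt]
    rcases le_or_gt t T with h' | h'
    · obtain ⟨l, hl⟩ := hf.2 t ⟨h, h'⟩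
      rw [nhdsWithin_Ico_eq_nhdsLT h] at hl
      refine ⟨l, hl.congr' ?_, fun _ => ?_⟩
      · filter_upwards [Ioo_mem_nhdsLT h] with x hx
        exact (hFI x ⟨hx.1.le, hx.2.le.trans h'⟩).symm
      · rw [leftLimIn, if_pos h, leftLim_eq_of_tendsto hl]
    · refine ⟨f T, ?_, fun h0 => absurd h0.2 h'.not_ge⟩
      refine tendsto_const_nhds.congr' ?_
      filter_upwards [Ioo_mem_nhdsLT h'] with x hx
      exact (hFT x hx.1.le).symm
  choose L hL hL' using hleft
  refine ⟨L, ⟨hright, hL⟩, hFI, hL', fun t => ?_⟩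
  rw [hFI (max 0 (min t T)) ⟨le_max_left _ _, max_le hT.le (min_le_right _ _)⟩]

lemma IsCadlagExtension.exists_isParamRep {T : ℝ} (hT : 0 < T) {f F L : ℝ → ℝ}
    (h : IsCadlagExtension T f F L) : ∃ r u, IsParamRep f 0 T r u := by
  obtain ⟨r, u, φm, φp, hr, hu, hmono, hmem, hsurj, hord, hend, hle, hlt⟩ :=
    h.cadlag.exists_graph_path
  have h0 : (0 : ℝ) ∈ Icc 0 T := ⟨le_rfl, hT.le⟩
  have hT' : T ∈ Icc 0 T := ⟨hT.le, le_rfl⟩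
  have hL0 : L 0 = f 0 := by
    rw [← h.leftLim_eq 0 h0]
    simp [leftLimIn]
  set A := φm 0
  set B := φp T
  have hAB : A < B := (hle 0).trans_lt ((hlt 0 T hT).trans_le (hle T))
  set σ : ℝ → ℝ := fun s => A + (B - A) * s with hσ
  have hσmono : ∀ s s', s ≤ s' → σ s ≤ σ s' := fun s s' hs => by
    simp only [hσ]; nlinarith
  have hσc : Continuous σ := by fun_prop
  have hσ0 : σ 0 = A := by simp [hσ]
  have hσ1 : σ 1 = B := by simp [hσ]
  have hrA : r A = 0 := (hend 0).1
  have hrB : r B = T := (hend T).2.2.1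
  have hrI : ∀ s ∈ Icc (0 : ℝ) 1, r (σ s) ∈ Icc 0 T := fun s hs =>
    ⟨by rw [← hrA, ← hσ0]; exact hmono (hσmono _ _ hs.1),
      by rw [← hrB, ← hσ1]; exact hmono (hσmono _ _ hs.2)⟩
  refine ⟨r ∘ σ, u ∘ σ, ?_, ?_, ?_, ?_, ?_, ?_⟩
  · exact ((hr.comp hσc).prodMk (hu.comp hσc)).continuousOn
  · intro s hs
    obtain ⟨α, hα, hα'⟩ := hmem (σ s)
    refine ⟨hrI s hs, α, hα, ?_⟩
    simp only [Function.comp, smul_eq_mul]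
    rw [h.leftLim_eq _ (hrI s hs), ← h.eqOn _ (hrI s hs), hα']
  · rintro ⟨t, v⟩ ⟨ht, α, hα, hv⟩
    obtain ⟨x, hx, hxt, hxv⟩ := hsurj t α hα
    dsimp only at ht hv
    have hAx : A ≤ x := by
      refine le_trans ?_ hx.1
      rcases ht.1.eq_or_lt with h1 | h1
      · rw [← h1]
      · exact (hle 0).trans (hlt 0 t h1).le
    have hxB : x ≤ B := by
      refine le_trans hx.2 ?_
      rcases ht.2.eq_or_lt with h1 | h1
      · rw [h1]
      · exact (hlt t T h1).le.trans (hle T)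
    have hBA : 0 < B - A := sub_pos.2 hAB
    refine ⟨(x - A) / (B - A), ⟨div_nonneg (by linarith) hBA.le,
      (div_le_one hBA).2 (by linarith)⟩, ?_⟩
    have : σ ((x - A) / (B - A)) = x := by
      simp only [hσ]; field_simp; ring
    simp only [Function.comp, this, hxt, hxv, Prod.mk.injEq, true_and]
    rw [hv, h.leftLim_eq _ ht, h.eqOn _ ht, smul_eq_mul, smul_eq_mul]
  · intro s hs s' hs' hss
    rcases (hmono (hσmono _ _ hss)).lt_or_eq with h1 | h1
    · exact Or.inl h1
    · refine Or.inr ⟨h1, ?_⟩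
      simp only [Function.comp, Real.norm_eq_abs]
      rw [h.leftLim_eq _ (hrI s hs)]
      exact hord _ _ (hσmono _ _ hss) h1
  · simp only [Function.comp, hσ0]
    exact ⟨hrA, by rw [(hend 0).2.1, hL0]⟩
  · simp only [Function.comp, hσ1]
    exact ⟨hrB, by rw [(hend T).2.2.2, h.eqOn T hT']⟩

/-- `v` lies within distance `c` of the interval spanned by `a` and `b`. -/
def NearHull (c a v b : ℝ) : Prop := min a b - c ≤ v ∧ v ≤ max a b + c

lemma NearHull.segDist_le {c a v b : ℝ} (hc : 0 ≤ c) (h : NearHull c a v b) :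
    segDist a v b ≤ c := by
  set p := max (min a b) (min v (max a b)) with hp
  have hmM : min a b ≤ max a b := min_le_max
  have hpI : p ∈ uIcc a b := ⟨le_max_left _ _, max_le hmM (min_le_right _ _)⟩
  rw [← segment_eq_uIcc] at hpI
  obtain ⟨α, β, hα, hβ, hαβ, hpe⟩ := hpI
  have hle : segDist a v b ≤ ‖v - (α • a + (1 - α) • b)‖ :=
    csInf_le ⟨0, by rintro d ⟨_, _, rfl⟩; exact norm_nonneg _⟩
      ⟨α, ⟨hα, by linarith⟩, rfl⟩
  refine hle.trans ?_
  rw [show 1 - α = β by linarith, hpe, Real.norm_eq_abs, abs_le]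
  obtain ⟨h1, h2⟩ := h
  rcases le_total v (max a b) with h3 | h3 <;> rcases le_total (min a b) v with h4 | h4 <;>
    simp only [hp, h3, h4, min_eq_left, min_eq_right, max_eq_left, max_eq_right, hmM] <;>
    constructor <;> linarith

lemma nearHull_segDist (a v b : ℝ) : NearHull (segDist a v b) a v b := by
  have key : ∀ x, (∀ α ∈ Icc (0 : ℝ) 1, x ≤ ‖v - (α • a + (1 - α) • b)‖) →
      x ≤ segDist a v b := fun x hx =>
    le_csInf ⟨_, 0, ⟨le_rfl, zero_le_one⟩, rfl⟩ (by rintro d ⟨α, hα, rfl⟩; exact hx α hα)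
  have hcomb : ∀ α ∈ Icc (0 : ℝ) 1, α • a + (1 - α) • b ∈ Icc (min a b) (max a b) :=
    fun α hα => convex_Icc _ _ ⟨min_le_left _ _, le_max_left _ _⟩
      ⟨min_le_right _ _, le_max_right _ _⟩ hα.1 (sub_nonneg.2 hα.2) (by ring)
  constructor
  · have := key (min a b - v) fun α hα => by
      have := (hcomb α hα).1
      rw [Real.norm_eq_abs]
      linarith [neg_abs_le (v - (α • a + (1 - α) • b))]
    linarith
  · have := key (v - max a b) fun α hα => by
      have := (hcomb α hα).2
      rw [Real.norm_eq_abs]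
      linarith [le_abs_self (v - (α • a + (1 - α) • b))]
    linarith

lemma NearHull.mono {c c' a v b : ℝ} (h : NearHull c a v b) (hc : c ≤ c') :
    NearHull c' a v b := ⟨by linarith [h.1], by linarith [h.2]⟩

lemma NearHull.perturb {c η a v b a' v' b' : ℝ} (h : NearHull c a v b) (ha : |a' - a| ≤ η)
    (hv : |v' - v| ≤ η) (hb : |b' - b| ≤ η) : NearHull (c + 2 * η) a' v' b' := by
  rw [abs_le] at ha hv hb
  obtain ⟨h1, h2⟩ := h
  constructor
  · have : min a' b' ≤ min a b + η := by
      rw [← min_add_add_right]; exact min_le_min (by linarith) (by linarith)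
    linarith
  · have : max a b ≤ max a' b' + η := by
      rw [← max_add_add_right]; exact max_le_max (by linarith) (by linarith)
    linarith

/-- The `M₁` oscillation of `F` at scale `δ` is at most `ε`. -/
def OscLE (F : ℝ → ℝ) (δ ε : ℝ) : Prop :=
  ∀ t₁ t t₂, t₁ ≤ t → t ≤ t₂ → t₂ - t₁ < δ → NearHull ε (F t₁) (F t) (F t₂)

lemma OscLE.neg {F : ℝ → ℝ} {δ ε : ℝ} (h : OscLE F δ ε) : OscLE (fun t => -F t) δ ε := by
  intro t₁ t t₂ h1 h2 h3
  obtain ⟨h4, h5⟩ := h t₁ t t₂ h1 h2 h3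
  constructor
  · rw [min_neg_neg]; linarith
  · rw [max_neg_neg]; linarith

/-- `(t, v)` lies on the completed graph. -/
def OnGraph (F L : ℝ → ℝ) (t v : ℝ) : Prop :=
  ∃ α ∈ Icc (0 : ℝ) 1, v = α * L t + (1 - α) * F t

/-- The order of the completed graph. -/
def GraphPrec (L : ℝ → ℝ) (t v t' v' : ℝ) : Prop :=
  t < t' ∨ t = t' ∧ |L t - v| ≤ |L t - v'|

lemma OnGraph.neg {F L : ℝ → ℝ} {t v : ℝ} (h : OnGraph F L t v) :
    OnGraph (fun t => -F t) (fun t => -L t) t (-v) := by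
  obtain ⟨α, hα, rfl⟩ := h
  exact ⟨α, hα, by ring⟩

lemma GraphPrec.neg {L : ℝ → ℝ} {t v t' v' : ℝ} (h : GraphPrec L t v t' v') :
    GraphPrec (fun t => -L t) t (-v) t' (-v') := by
  refine h.imp_right fun h => ⟨h.1, ?_⟩
  rw [neg_sub_neg, neg_sub_neg, abs_sub_comm, abs_sub_comm v']
  exact h.2

lemma HasCadlagLimits.exists_lt_of_leftLim_lt {F L : ℝ → ℝ} (h : HasCadlagLimits F L)
    {t a c : ℝ} (ha : a < t) (hc : L t < c) : ∃ x ∈ Ioo a t, F x < c := by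
  obtain ⟨x, hx, hx'⟩ := (((h.left t).eventually (gt_mem_nhds hc)).and
    (Ioo_mem_nhdsLT ha)).exists
  exact ⟨x, hx', hx⟩

lemma OnGraph.exists_lt {F L : ℝ → ℝ} (h : HasCadlagLimits F L) {t v a c : ℝ}
    (hv : OnGraph F L t v) (ha : a < t) (hc : v < c) : ∃ x ∈ Ioc a t, F x < c := by
  by_cases hF : F t < c
  · exact ⟨t, ⟨ha, le_rfl⟩, hF⟩
  · have hL : L t < c := by
      obtain ⟨α, hα, rfl⟩ := hv
      by_contra! hL
      nlinarith [hα.1, hα.2]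
    obtain ⟨x, hx, hx'⟩ := h.exists_lt_of_leftLim_lt ha hL
    exact ⟨x, ⟨hx.1, hx.2.le⟩, hx'⟩

lemma OnGraph.exists_gt {F L : ℝ → ℝ} (h : HasCadlagLimits F L) {t v a c : ℝ}
    (hv : OnGraph F L t v) (ha : a < t) (hc : c < v) : ∃ x ∈ Ioc a t, c < F x := by
  obtain ⟨x, hx, hx'⟩ := hv.neg.exists_lt h.neg ha (neg_lt_neg hc)
  exact ⟨x, hx, by linarith⟩

/-- Moving up along the segment of the graph over `t` forces an upward jump. -/
lemma OnGraph.jump_of_lt {F L : ℝ → ℝ} {t v v' : ℝ} (hv : OnGraph F L t v)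
    (hv' : OnGraph F L t v') (h : |L t - v| ≤ |L t - v'|) (hlt : v < v') :
    L t ≤ v ∧ v' ≤ F t := by
  obtain ⟨α, hα, rfl⟩ := hv
  obtain ⟨β, hβ, rfl⟩ := hv'
  have e : ∀ x, L t - (x * L t + (1 - x) * F t) = (1 - x) * (L t - F t) := fun x => by ring
  rw [e, e, abs_mul, abs_mul, abs_of_nonneg (sub_nonneg.2 hα.2),
    abs_of_nonneg (sub_nonneg.2 hβ.2)] at h
  have hne : L t ≠ F t := by
    intro h0
    rw [h0] at hlt
    nlinarith
  have hle : β ≤ α := by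
    have := le_of_mul_le_mul_right h (abs_pos.2 (sub_ne_zero.2 hne))
    linarith
  have hLF : L t < F t := by
    by_contra! h1
    nlinarith
  constructor <;> nlinarith [hα.1, hα.2, hβ.1, hβ.2]

lemma OscLE.graph_le {F L : ℝ → ℝ} (h : HasCadlagLimits F L) {δ ε : ℝ} (hε : 0 ≤ ε)
    (hosc : OscLE F δ ε) {t₁ t t₂ v₁ v v₂ : ℝ} (h₁ : OnGraph F L t₁ v₁) (hv : OnGraph F L t v)
    (h₂ : OnGraph F L t₂ v₂) (ho₁ : GraphPrec L t₁ v₁ t v) (ho₂ : GraphPrec L t v t₂ v₂)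
    (hδ : t₂ - t₁ < δ) : v ≤ max v₁ v₂ + ε := by
  by_contra! hlt
  set κ := (v - max v₁ v₂ - ε) / 2 with hκ
  have hκ0 : 0 < κ := by rw [hκ]; linarith
  have hm1 := le_max_left v₁ v₂
  have hm2 := le_max_right v₁ v₂
  have key : ∀ x₁ x x₂, x₁ ≤ x → x ≤ x₂ → x₂ - x₁ < δ → F x₁ < max v₁ v₂ + κ →
      v - κ < F x → F x₂ < max v₁ v₂ + κ → False := by
    intro x₁ x x₂ h1 h2 h3 h4 h5 h6
    have := (hosc x₁ x x₂ h1 h2 h3).2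
    have := max_lt h4 h6
    linarith
  have htt₁ : t₁ ≤ t := ho₁.elim le_of_lt fun h => h.1.le
  have htt₂ : t ≤ t₂ := ho₂.elim le_of_lt fun h => h.1.le
  have hv1 : v₁ < max v₁ v₂ + κ := by linarith
  have hv2 : v₂ < max v₁ v₂ + κ := by linarith
  have hvk : v - κ < v := by linarith
  have hδ' : t₂ - δ < t₁ := by linarith
  rcases ho₁ with ho₁ | ⟨rfl, ho₁⟩
  · obtain ⟨x₁, hx₁, hF₁⟩ := h₁.exists_lt h hδ' hv1
    rcases ho₂ with ho₂ | ⟨rfl, ho₂⟩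
    · obtain ⟨x, hx, hF⟩ := hv.exists_gt h ho₁ hvk
      obtain ⟨x₂, hx₂, hF₂⟩ := h₂.exists_lt h ho₂ hv2
      exact key x₁ x x₂ (by linarith [hx₁.2, hx.1]) (by linarith [hx.2, hx₂.1])
        (by linarith [hx₁.1, hx₂.2]) hF₁ hF hF₂
    · have hj := hv.neg.jump_of_lt h₂.neg
        (by rw [neg_sub_neg, neg_sub_neg, abs_sub_comm, abs_sub_comm v₂]; exact ho₂)
        (by linarith)
      obtain ⟨x, hx, hF⟩ := h.neg.exists_lt_of_leftLim_lt (c := -(v - κ)) ho₁ (by linarith [hj.1])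
      exact key x₁ x t (by linarith [hx₁.2, hx.1]) hx.2.le (by linarith [hx₁.1]) hF₁
        (by linarith) (by linarith [hj.2])
  · have hj := h₁.jump_of_lt hv ho₁ (by linarith)
    rcases ho₂ with ho₂ | ⟨rfl, ho₂⟩
    · obtain ⟨x₁, hx₁, hF₁⟩ := h.exists_lt_of_leftLim_lt (c := max v₁ v₂ + κ) hδ'
        (by linarith [hj.1])
      obtain ⟨x₂, hx₂, hF₂⟩ := h₂.exists_lt h ho₂ hv2
      exact key x₁ t₁ x₂ hx₁.2.le hx₂.1.le (by linarith [hx₁.1, hx₂.2]) hF₁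
        (by linarith [hj.2]) hF₂
    · have hj' := hv.neg.jump_of_lt h₂.neg
        (by rw [neg_sub_neg, neg_sub_neg, abs_sub_comm, abs_sub_comm v₂]; exact ho₂)
        (by linarith)
      linarith [hj.1, hj'.1]

lemma OscLE.nearHull_graph {F L : ℝ → ℝ} (h : HasCadlagLimits F L) {δ ε : ℝ} (hε : 0 ≤ ε)
    (hosc : OscLE F δ ε) {t₁ t t₂ v₁ v v₂ : ℝ} (h₁ : OnGraph F L t₁ v₁) (hv : OnGraph F L t v)
    (h₂ : OnGraph F L t₂ v₂) (ho₁ : GraphPrec L t₁ v₁ t v) (ho₂ : GraphPrec L t v t₂ v₂)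
    (hδ : t₂ - t₁ < δ) : NearHull ε v₁ v v₂ := by
  refine ⟨?_, hosc.graph_le h hε h₁ hv h₂ ho₁ ho₂ hδ⟩
  have := hosc.neg.graph_le h.neg hε h₁.neg hv.neg h₂.neg ho₁.neg ho₂.neg hδ
  rw [max_neg_neg] at this
  linarith

lemma HasCadlagLimits.oscLE_of_rat {F L : ℝ → ℝ} (h : HasCadlagLimits F L) {δ ε : ℝ}
    (hε : 0 ≤ ε) (hrat : ∀ a b c : ℚ, (c : ℝ) - a < δ → a < b → b < c →
      NearHull ε (F a) (F b) (F c)) : OscLE F δ ε := by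
  have happ : ∀ t b η : ℝ, t < b → 0 < η → ∃ q : ℚ, t < q ∧ (q : ℝ) < b ∧ |F q - F t| ≤ η := by
    intro t b η hb hη
    obtain ⟨b', hb', hF⟩ := h.near_right t hη
    obtain ⟨q, hq, hq'⟩ := exists_rat_btwn (lt_min hb hb')
    obtain ⟨⟨h1, h2⟩, -⟩ := hF q ⟨hq, hq'.trans_le (min_le_right _ _)⟩
    exact ⟨q, hq, hq'.trans_le (min_le_left _ _), abs_le.2 ⟨by linarith, by linarith⟩⟩
  intro t₁ t t₂ h1 h2 hδ
  have hη : ∀ η > 0, NearHull (ε + 2 * η) (F t₁) (F t) (F t₂) := by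
    intro η hη
    rcases h1.eq_or_lt with rfl | h1
    · exact ⟨by linarith [min_le_left (F t₁) (F t₂)], by linarith [le_max_left (F t₁) (F t₂)]⟩
    rcases h2.eq_or_lt with rfl | h2
    · exact ⟨by linarith [min_le_right (F t₁) (F t)], by linarith [le_max_right (F t₁) (F t)]⟩
    obtain ⟨c, hc, hc', hFc⟩ := happ t₂ (t₁ + δ) η (by linarith) hη
    obtain ⟨a, ha, ha', hFa⟩ := happ t₁ t η h1 hη
    obtain ⟨b, hb, hb', hFb⟩ := happ t t₂ η h2 hη
    have := hrat a b c (by linarith) (by exact_mod_cast ha'.trans hb)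
      (by exact_mod_cast hb'.trans hc)
    rw [abs_sub_comm] at hFa hFb hFc
    exact this.perturb hFa hFb hFc
  constructor
  · refine le_of_forall_pos_le_add fun η hη' => ?_
    linarith [(hη (η / 2) (by linarith)).1]
  · refine le_of_forall_pos_le_add fun η hη' => ?_
    linarith [(hη (η / 2) (by linarith)).2]

lemma IsCadlagExtension.exists_oscLE {T : ℝ} (hT : 0 < T) {f F L : ℝ → ℝ}
    (h : IsCadlagExtension T f F L) {ε : ℝ} (hε : 0 < ε) : ∃ δ > 0, OscLE F δ ε := by
  have hloc : ∀ t : ℝ, ∃ a < t, ∃ b > t, (∀ x ∈ Ioo a t, F x ∈ Icc (L t - ε / 2) (L t + ε / 2)) ∧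
      ∀ x ∈ Ico t b, F x ∈ Icc (F t - ε / 2) (F t + ε / 2) := by
    intro t
    obtain ⟨a, ha, ha'⟩ := h.cadlag.near_left t (half_pos hε)
    obtain ⟨b, hb, hb'⟩ := h.cadlag.near_right t (half_pos hε)
    refine ⟨a, ha, b, hb, fun x hx => (ha' x hx).1, fun x hx => ?_⟩
    rcases hx.1.eq_or_lt with rfl | h1
    · exact ⟨by linarith, by linarith⟩
    · exact (hb' x ⟨h1, hx.2⟩).1
  choose a ha b hb hl hr using hloc
  obtain ⟨δ, hδ, hδ'⟩ := lebesgue_number_lemma_of_metric (s := Icc 0 T)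
    (c := fun t => Ioo (a t) (b t)) isCompact_Icc (fun _ => isOpen_Ioo)
    (fun t _ => mem_iUnion.2 ⟨t, ha t, hb t⟩)
  refine ⟨δ, hδ, fun t₁ t t₂ h1 h2 h3 => ?_⟩
  set κ : ℝ → ℝ := fun t => max 0 (min t T) with hκ
  have hκm : Monotone κ := fun x y hxy => max_le_max le_rfl (min_le_min hxy le_rfl)
  have hκI : ∀ x, κ x ∈ Icc 0 T := fun x => ⟨le_max_left _ _, max_le hT.le (min_le_right _ _)⟩
  have hκl : κ t₂ - κ t₁ < δ := by
    have : κ t₂ ≤ κ t₁ + (t₂ - t₁) := by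
      simp only [hκ]
      refine max_le ?_ ?_
      · linarith [le_max_left 0 (min t₁ T)]
      · rcases le_total t₁ T with h | h
        · linarith [le_max_right 0 (min t₁ T), min_le_left t₂ T, min_eq_left h]
        · linarith [le_max_right 0 (min t₁ T), min_le_right t₂ T, min_eq_right h]
    linarith
  rw [h.clamp t₁, h.clamp t, h.clamp t₂]
  change NearHull ε (F (κ t₁)) (F (κ t)) (F (κ t₂))
  obtain ⟨i, hi⟩ := hδ' (κ t₁) (hκI t₁)
  have hk1 := hκm h1
  have hk2 := hκm h2
  have hmem : ∀ x, κ t₁ ≤ x → x ≤ κ t₂ → x ∈ Ioo (a i) (b i) := fun x h4 h5 => hi (by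
    rw [Metric.mem_ball, Real.dist_eq, abs_lt]; constructor <;> linarith)
  have m1 := hmem _ le_rfl (hk1.trans hk2)
  have m := hmem _ hk1 hk2
  have m2 := hmem _ (hk1.trans hk2) le_rfl
  rcases lt_or_ge (κ t) i with h4 | h4
  · have e1 := hl i _ ⟨m1.1, hk1.trans_lt h4⟩
    have e2 := hl i _ ⟨m.1, h4⟩
    constructor
    · linarith [min_le_left (F (κ t₁)) (F (κ t₂)), e1.2, e2.1]
    · linarith [le_max_left (F (κ t₁)) (F (κ t₂)), e1.1, e2.2]
  · have e1 := hr i _ ⟨h4.trans hk2, m2.2⟩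
    have e2 := hr i _ ⟨h4, m.2⟩
    constructor
    · linarith [min_le_right (F (κ t₁)) (F (κ t₂)), e1.2, e2.1]
    · linarith [le_max_right (F (κ t₁)) (F (κ t₂)), e1.1, e2.2]

lemma HasCadlagLimits.mem_of_rat_mem {F L : ℝ → ℝ} (h : HasCadlagLimits F L) {S : Set ℝ}
    (hS : IsClosed S) {a b : ℝ} (hq : ∀ q : ℚ, (q : ℝ) ∈ Ioo a b → F q ∈ S) :
    ∀ x ∈ Ioo a b, F x ∈ S ∧ L x ∈ S := by
  have hF : ∀ x ∈ Ioo a b, F x ∈ S := by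
    intro x hx
    have hfr : ∃ᶠ y in 𝓝[>] x, F y ∈ S := by
      rw [frequently_iff]
      intro U hU
      obtain ⟨c, hc, hcU⟩ := mem_nhdsGT_iff_exists_Ioo_subset.1 hU
      obtain ⟨q, hxq, hqc⟩ := exists_rat_btwn (lt_min hc hx.2)
      exact ⟨q, hcU ⟨hxq, hqc.trans_le (min_le_left _ _)⟩,
        hq q ⟨hx.1.trans hxq, hqc.trans_le (min_le_right _ _)⟩⟩
    exact hS.mem_of_frequently_of_tendsto hfr (h.right x)
  exact fun x hx => ⟨hF x hx, h.leftLim_mem hS hF x hx⟩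

lemma OnGraph.mem_convex {F L : ℝ → ℝ} {t v : ℝ} (h : OnGraph F L t v) {S : Set ℝ}
    (hS : Convex ℝ S) (hF : F t ∈ S) (hL : L t ∈ S) : v ∈ S := by
  obtain ⟨α, hα, rfl⟩ := h
  exact hS hL hF hα.1 (sub_nonneg.2 hα.2) (by ring)

section ParamRep

variable {T : ℝ} {f F L : ℝ → ℝ} {r u : ℝ → ℝ}

lemma IsParamRep.onGraph (h : IsCadlagExtension T f F L) (hr : IsParamRep f 0 T r u) {s : ℝ}
    (hs : s ∈ Icc (0 : ℝ) 1) : OnGraph F L (r s) (u s) := by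
  obtain ⟨ht, α, hα, hv⟩ := hr.mem s hs
  refine ⟨α, hα, ?_⟩
  dsimp only at ht hv
  rw [hv, h.leftLim_eq _ ht, h.eqOn _ ht, smul_eq_mul, smul_eq_mul]

lemma IsParamRep.graphPrec (h : IsCadlagExtension T f F L) (hr : IsParamRep f 0 T r u) {s s' : ℝ}
    (hs : s ∈ Icc (0 : ℝ) 1) (hs' : s' ∈ Icc (0 : ℝ) 1) (hss : s ≤ s') :
    GraphPrec L (r s) (u s) (r s') (u s') := by
  have := hr.mono s hs s' hs' hss
  simp only [graphLE, h.leftLim_eq _ (hr.mem s hs).1, Real.norm_eq_abs] at this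
  exact this

lemma IsParamRep.monotoneOn (hr : IsParamRep f 0 T r u) : MonotoneOn r (Icc 0 1) :=
  fun s hs s' hs' hss => (hr.mono s hs s' hs' hss).elim le_of_lt fun h => h.1.le

lemma IsParamRep.exists_eq (hr : IsParamRep f 0 T r u) {t : ℝ} (ht : t ∈ Icc 0 T) :
    ∃ s ∈ Icc (0 : ℝ) 1, r s = t ∧ u s = f t := by
  obtain ⟨s, hs, hst⟩ := hr.surj (t, f t) ⟨ht, 0, ⟨le_rfl, zero_le_one⟩, by simp⟩
  exact ⟨s, hs, (Prod.mk.inj hst).1, (Prod.mk.inj hst).2⟩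

lemma IsParamRep.nearHull (h : IsCadlagExtension T f F L) (hr : IsParamRep f 0 T r u) {δ ε : ℝ}
    (hε : 0 ≤ ε) (hosc : OscLE F δ ε) {s₁ s s₂ : ℝ} (h₁ : 0 ≤ s₁) (h12 : s₁ ≤ s) (h23 : s ≤ s₂)
    (h₂ : s₂ ≤ 1) (hδ : r s₂ - r s₁ < δ) : NearHull ε (u s₁) (u s) (u s₂) := by
  have m₁ : s₁ ∈ Icc (0 : ℝ) 1 := ⟨h₁, by linarith⟩
  have m : s ∈ Icc (0 : ℝ) 1 := ⟨by linarith, by linarith⟩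
  have m₂ : s₂ ∈ Icc (0 : ℝ) 1 := ⟨by linarith, h₂⟩
  exact hosc.nearHull_graph h.cadlag hε (hr.onGraph h m₁) (hr.onGraph h m) (hr.onGraph h m₂)
    (hr.graphPrec h m₁ m h12) (hr.graphPrec h m m₂ h23) hδ

lemma IsParamRep.comp (hr : IsParamRep f 0 T r u) {κ : ℝ → ℝ} (hκ : ContinuousOn κ (Icc 0 1))
    (hm : MonotoneOn κ (Icc 0 1)) (h0 : κ 0 = 0) (h1 : κ 1 = 1) :
    IsParamRep f 0 T (r ∘ κ) (u ∘ κ) := by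
  have m0 : (0 : ℝ) ∈ Icc (0 : ℝ) 1 := ⟨le_rfl, zero_le_one⟩
  have m1 : (1 : ℝ) ∈ Icc (0 : ℝ) 1 := ⟨zero_le_one, le_rfl⟩
  have hmaps : MapsTo κ (Icc 0 1) (Icc 0 1) := fun s hs =>
    ⟨h0 ▸ hm m0 hs hs.1, h1 ▸ hm hs m1 hs.2⟩
  refine ⟨hr.contOn.comp hκ hmaps, fun s hs => hr.mem _ (hmaps hs), fun p hp => ?_,
    fun s hs s' hs' hss => hr.mono _ (hmaps hs) _ (hmaps hs') (hm hs hs' hss), ?_, ?_⟩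
  · obtain ⟨s, hs, hsp⟩ := hr.surj p hp
    have hs' := hs
    rw [← h0, ← h1] at hs
    obtain ⟨x, hx, rfl⟩ := intermediate_value_Icc zero_le_one hκ hs
    exact ⟨x, hx, hsp⟩
  · simpa [h0] using hr.init
  · simpa [h1] using hr.last

lemma IsParamRep.continuousOn_fst (hr : IsParamRep f 0 T r u) : ContinuousOn r (Icc 0 1) :=
  continuous_fst.comp_continuousOn hr.contOn

lemma IsParamRep.continuousOn_snd (hr : IsParamRep f 0 T r u) : ContinuousOn u (Icc 0 1) :=
  continuous_snd.comp_continuousOn hr.contOn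

end ParamRep

lemma abs_le_iSup_Icc {w : ℝ → ℝ} (hw : ContinuousOn w (Icc 0 1)) {s : ℝ}
    (hs : s ∈ Icc (0 : ℝ) 1) : |w s| ≤ ⨆ s : Icc (0 : ℝ) 1, |w s.1| := by
  have hb : BddAbove (range fun s : Icc (0 : ℝ) 1 => |w s.1|) := by
    have := isCompact_Icc.bddAbove_image hw.abs
    refine this.mono ?_
    rintro _ ⟨x, rfl⟩
    exact ⟨x.1, x.2, rfl⟩
  exact le_ciSup hb ⟨s, hs⟩

lemma exists_isParamRep_of_dM_lt {T : ℝ} (hT : 0 < T) {f F L g G K : ℝ → ℝ}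
    (hf : IsCadlagExtension T f F L) (hg : IsCadlagExtension T g G K) {η : ℝ}
    (h : dM 0 T f g < η) : ∃ r₁ u₁ r₂ u₂, IsParamRep f 0 T r₁ u₁ ∧ IsParamRep g 0 T r₂ u₂ ∧
      ∀ s ∈ Icc (0 : ℝ) 1, |r₁ s - r₂ s| ≤ η ∧ |u₁ s - u₂ s| ≤ η := by
  obtain ⟨a₁, b₁, hab₁⟩ := hf.exists_isParamRep hT
  obtain ⟨a₂, b₂, hab₂⟩ := hg.exists_isParamRep hT
  unfold dM at h
  obtain ⟨d, ⟨r₁, u₁, r₂, u₂, h₁, h₂, rfl⟩, hd⟩ := exists_lt_of_csInf_lt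
    (by exact ⟨_, a₁, b₁, a₂, b₂, hab₁, hab₂, rfl⟩) h
  obtain ⟨hd₁, hd₂⟩ := max_lt_iff.1 hd
  exact ⟨r₁, u₁, r₂, u₂, h₁, h₂, fun s hs =>
    ⟨(abs_le_iSup_Icc (h₁.continuousOn_fst.sub h₂.continuousOn_fst) hs).trans hd₁.le,
      (abs_le_iSup_Icc (h₁.continuousOn_snd.sub h₂.continuousOn_snd) hs).trans hd₂.le⟩⟩

lemma dM_le_of_isParamRep {T c : ℝ} {f g r₁ u₁ r₂ u₂ : ℝ → ℝ}
    (h₁ : IsParamRep f 0 T r₁ u₁) (h₂ : IsParamRep g 0 T r₂ u₂)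
    (hr : ∀ s ∈ Icc (0 : ℝ) 1, |r₁ s - r₂ s| ≤ c) (hu : ∀ s ∈ Icc (0 : ℝ) 1, |u₁ s - u₂ s| ≤ c) :
    dM 0 T f g ≤ c := by
  have hne : Nonempty (Icc (0 : ℝ) 1) := ⟨⟨0, le_rfl, zero_le_one⟩⟩
  have hc : max (⨆ s : Icc (0 : ℝ) 1, |r₁ s.1 - r₂ s.1|)
      (⨆ s : Icc (0 : ℝ) 1, ‖u₁ s.1 - u₂ s.1‖) ≤ c :=
    max_le (ciSup_le fun s => hr s.1 s.2) (ciSup_le fun s => hu s.1 s.2)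
  refine (csInf_le ?_ ?_).trans hc
  · refine ⟨0, ?_⟩
    rintro d ⟨_, _, _, _, -, -, rfl⟩
    exact le_max_of_le_left (Real.iSup_nonneg fun _ => abs_nonneg _)
  · exact ⟨r₁, u₁, r₂, u₂, h₁, h₂, rfl⟩

lemma IsCadlagExtension.segDist_le_oscM {T : ℝ} (hT : 0 < T) {f F L : ℝ → ℝ}
    (h : IsCadlagExtension T f F L) {δ t₁ t t₂ : ℝ} (h0 : 0 ≤ t₁) (h1 : t₁ < t) (h2 : t < t₂)
    (h3 : t₂ ≤ T) (hδ : t₂ - t₁ ≤ δ) : segDist (f t₁) (f t) (f t₂) ≤ oscM f 0 T δ := by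
  obtain ⟨r, u, hru⟩ := h.exists_isParamRep hT
  obtain ⟨C, hC⟩ := isCompact_Icc.exists_bound_of_continuousOn hru.continuousOn_snd
  have hb : ∀ x, 0 ≤ x → x ≤ T → |f x| ≤ C := by
    intro x hx hx'
    obtain ⟨s, hs, -, hsx⟩ := hru.exists_eq ⟨hx, hx'⟩
    rw [← hsx]
    exact hC s hs
  refine le_csSup ⟨2 * C, ?_⟩ ⟨t₁, t, t₂, h0, h1, h2, h3, hδ, rfl⟩
  rintro d ⟨a, b, c, ha, hab, hbc, hc, -, rfl⟩
  have h1 := abs_le.1 (hb a ha (by linarith))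
  have h2 := abs_le.1 (hb b (by linarith) (by linarith))
  refine NearHull.segDist_le (by linarith [h1.1, h1.2]) ⟨?_, ?_⟩
  · linarith [min_le_left (f a) (f c), h1.2, h2.1]
  · linarith [le_max_left (f a) (f c), h1.1, h2.2]

lemma IsCadlagExtension.oscLE_of_oscM_le {T : ℝ} (hT : 0 < T) {f F L : ℝ → ℝ}
    (h : IsCadlagExtension T f F L) {δ η : ℝ} (hη : 0 ≤ η) (hosc : oscM f 0 T δ ≤ η) :
    OscLE F δ η := by
  intro t₁ t t₂ h1 h2 h3
  rw [h.clamp t₁, h.clamp t, h.clamp t₂]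
  set κ : ℝ → ℝ := fun t => max 0 (min t T) with hκ
  change NearHull η (F (κ t₁)) (F (κ t)) (F (κ t₂))
  have hκm : Monotone κ := fun x y hxy => max_le_max le_rfl (min_le_min hxy le_rfl)
  have hκI : ∀ x, κ x ∈ Icc 0 T := fun x => ⟨le_max_left _ _, max_le hT.le (min_le_right _ _)⟩
  have hκl : κ t₂ - κ t₁ ≤ δ := by
    have : κ t₂ ≤ κ t₁ + (t₂ - t₁) := by
      simp only [hκ]
      refine max_le ?_ ?_
      · linarith [le_max_left 0 (min t₁ T)]
      · rcases le_total t₁ T with h | h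
        · linarith [le_max_right 0 (min t₁ T), min_le_left t₂ T, min_eq_left h]
        · linarith [le_max_right 0 (min t₁ T), min_le_right t₂ T, min_eq_right h]
    linarith
  rcases (hκm h1).eq_or_lt with e1 | e1
  · rw [e1]
    exact ⟨by linarith [min_le_left (F (κ t)) (F (κ t₂))],
      by linarith [le_max_left (F (κ t)) (F (κ t₂))]⟩
  rcases (hκm h2).eq_or_lt with e2 | e2
  · rw [e2]
    exact ⟨by linarith [min_le_right (F (κ t₁)) (F (κ t₂))],
      by linarith [le_max_right (F (κ t₁)) (F (κ t₂))]⟩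
  rw [h.eqOn _ (hκI _), h.eqOn _ (hκI _), h.eqOn _ (hκI _)]
  exact (nearHull_segDist _ _ _).mono
    ((h.segDist_le_oscM hT (hκI _).1 e1 e2 (hκI _).2 hκl).trans hosc)

lemma oscM_le_of_dM_lt {T : ℝ} (hT : 0 < T) {f F L g G K : ℝ → ℝ}
    (hf : IsCadlagExtension T f F L) (hg : IsCadlagExtension T g G K) {δ δ' η ε : ℝ}
    (hε : 0 ≤ ε) (hη : 0 ≤ η) (h : dM 0 T f g < η) (hosc : OscLE G δ' ε)
    (hδ : δ + 2 * η < δ') : oscM f 0 T δ ≤ ε + 2 * η := by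
  obtain ⟨r₁, u₁, r₂, u₂, h₁, h₂, hd⟩ := exists_isParamRep_of_dM_lt hT hf hg h
  refine Real.sSup_le ?_ (by linarith)
  rintro d ⟨a, b, c, ha, hab, hbc, hc, hac, rfl⟩
  obtain ⟨s₁, m₁, hs₁, e₁⟩ := h₁.exists_eq (t := a) ⟨ha, by linarith⟩
  obtain ⟨s, m, hs, e⟩ := h₁.exists_eq (t := b) ⟨by linarith, by linarith⟩
  obtain ⟨s₂, m₂, hs₂, e₂⟩ := h₁.exists_eq (t := c) ⟨by linarith, hc⟩
  have o₁ : s₁ ≤ s := by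
    by_contra! hlt
    linarith [h₁.monotoneOn m m₁ hlt.le]
  have o₂ : s ≤ s₂ := by
    by_contra! hlt
    linarith [h₁.monotoneOn m₂ m hlt.le]
  have d₁ := abs_le.1 (hd s₁ m₁).1
  have d₂ := abs_le.1 (hd s₂ m₂).1
  have key := h₂.nearHull hg hε hosc m₁.1 o₁ o₂ m₂.2 (by linarith [d₁.1, d₁.2, d₂.1, d₂.2])
  rw [← e₁, ← e, ← e₂]
  exact (key.perturb (hd s₁ m₁).2 (hd s m).2 (hd s₂ m₂).2).segDist_le (by linarith)

lemma abs_sub_le_of_dM_lt {T : ℝ} (hT : 0 < T) {f F L g G K : ℝ → ℝ}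
    (hf : IsCadlagExtension T f F L) (hg : IsCadlagExtension T g G K) {η ε ρ t : ℝ}
    (ht : t ∈ Icc 0 T) (h : dM 0 T f g < η) (hηρ : η < ρ)
    (hq : ∀ q : ℚ, |(q : ℝ) - t| < ρ → |G q - G t| ≤ ε) : |f t - g t| ≤ η + ε := by
  obtain ⟨r₁, u₁, r₂, u₂, h₁, h₂, hd⟩ := exists_isParamRep_of_dM_lt hT hf hg h
  obtain ⟨s, m, hs, e⟩ := h₁.exists_eq ht
  obtain ⟨hr, hu⟩ := hd s m
  have hS := hg.cadlag.mem_of_rat_mem (S := Icc (G t - ε) (G t + ε)) isClosed_Icc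
    (a := t - ρ) (b := t + ρ) (fun q hqI => by
      have := abs_le.1 (hq q (abs_lt.2 ⟨by linarith [hqI.1], by linarith [hqI.2]⟩))
      exact ⟨by linarith, by linarith⟩) (r₂ s) (by
      rw [hs] at hr
      have := abs_le.1 hr
      exact ⟨by linarith, by linarith⟩)
  have hmem := (h₂.onGraph hg m).mem_convex (convex_Icc _ _) hS.1 hS.2
  rw [e] at hu
  have := abs_le.1 hu
  rw [← hg.eqOn t ht, abs_le]
  constructor <;> linarith [hmem.1, hmem.2]

/-- `p` is joined to `q` inside `S` by a continuous path, nondecreasing in each coordinate. -/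
def MonoJoin (S : Set (ℝ × ℝ)) (p q : ℝ × ℝ) : Prop :=
  ∃ α β : ℝ → ℝ, Continuous α ∧ Continuous β ∧ Monotone α ∧ Monotone β ∧
    (α 0, β 0) = p ∧ (α 1, β 1) = q ∧ ∀ s ∈ Icc (0 : ℝ) 1, (α s, β s) ∈ S

namespace MonoJoin

variable {S : Set (ℝ × ℝ)}

lemma trans {p q w : ℝ × ℝ} (h₁ : MonoJoin S p q) (h₂ : MonoJoin S q w) : MonoJoin S p w := by
  obtain ⟨α, β, hα, hβ, mα, mβ, h0, h1, hS⟩ := h₁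
  obtain ⟨α', β', hα', hβ', mα', mβ', h0', h1', hS'⟩ := h₂
  have e := h1.trans h0'.symm
  rw [Prod.mk.injEq] at e
  have m₁ : Monotone fun s : ℝ => min (2 * s) 1 := fun x y hxy =>
    min_le_min (by linarith) le_rfl
  have m₂ : Monotone fun s : ℝ => max (2 * s - 1) 0 := fun x y hxy =>
    max_le_max (by linarith) le_rfl
  refine ⟨fun s => α (min (2 * s) 1) + (α' (max (2 * s - 1) 0) - α 1),
    fun s => β (min (2 * s) 1) + (β' (max (2 * s - 1) 0) - β 1), by fun_prop, by fun_prop,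
    fun x y hxy => add_le_add (mα (m₁ hxy)) (sub_le_sub_right (mα' (m₂ hxy)) _),
    fun x y hxy => add_le_add (mβ (m₁ hxy)) (sub_le_sub_right (mβ' (m₂ hxy)) _), ?_, ?_, ?_⟩
  · rw [← h0]
    norm_num [e.1, e.2]
  · rw [← h1']
    norm_num
  · intro s hs
    rcases le_total (2 * s) 1 with h | h
    · have h' : 2 * s - 1 ≤ 0 := by linarith
      simpa [h, h', e.1, e.2] using hS (2 * s) ⟨by linarith [hs.1], h⟩
    · have h' : 0 ≤ 2 * s - 1 := by linarith
      simpa [h, h'] using hS' (2 * s - 1) ⟨h', by linarith [hs.2]⟩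

lemma fst_move {a a' b : ℝ} (ha : a ≤ a') (h : ∀ x ∈ Icc a a', (x, b) ∈ S) :
    MonoJoin S (a, b) (a', b) := by
  refine ⟨fun s => a + s * (a' - a), fun _ => b, by fun_prop, by fun_prop, fun x y hxy => ?_,
    monotone_const, by simp, by simp, fun s hs => h _ ⟨?_, ?_⟩⟩ <;> dsimp only
  · nlinarith
  · nlinarith [hs.1]
  · nlinarith [hs.2]

lemma snd_move {a b b' : ℝ} (hb : b ≤ b') (h : ∀ y ∈ Icc b b', (a, y) ∈ S) :
    MonoJoin S (a, b) (a, b') := by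
  refine ⟨fun _ => a, fun s => b + s * (b' - b), by fun_prop, by fun_prop, monotone_const,
    fun x y hxy => ?_, by simp, by simp, fun s hs => h _ ⟨?_, ?_⟩⟩ <;> dsimp only
  · nlinarith
  · nlinarith [hs.1]
  · nlinarith [hs.2]

end MonoJoin

/-- The function `u` is monotone on `[a, a']` up to the error `η`. -/
def NearMonoOn (η : ℝ) (u : ℝ → ℝ) (a a' : ℝ) : Prop :=
  ∀ x y z, a ≤ x → x ≤ y → y ≤ z → z ≤ a' → NearHull η (u x) (u y) (u z)

lemma NearMonoOn.neg {η a a' : ℝ} {u : ℝ → ℝ} (h : NearMonoOn η u a a') :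
    NearMonoOn η (fun x => -u x) a a' := by
  intro x y z h1 h2 h3 h4
  obtain ⟨h5, h6⟩ := h x y z h1 h2 h3 h4
  constructor
  · rw [min_neg_neg]; linarith
  · rw [max_neg_neg]; linarith

lemma NearMonoOn.monoJoin_of_le {u v : ℝ → ℝ} {η a' b' : ℝ} (hη : 0 < η) {S : Set (ℝ × ℝ)}
    (n : ℕ) : ∀ a b, a ≤ a' → b ≤ b' → ContinuousOn u (Icc a a') → ContinuousOn v (Icc b b') →
    NearMonoOn η u a a' → NearMonoOn η v b b' → |u a - v b| ≤ η → |u a' - v b'| ≤ η →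
    u a ≤ u a' → u a' ≤ u a + n * η →
    (∀ x ∈ Icc a a', ∀ y ∈ Icc b b', |u x - v y| ≤ 5 * η → (x, y) ∈ S) →
    MonoJoin S (a, b) (a', b') := by
  induction n with
  | zero =>
    intro a b ha hb hu hv mu mv h h' hle hn hS
    rw [abs_le] at h h'
    simp only [Nat.cast_zero, zero_mul, add_zero] at hn
    have he : u a' = u a := le_antisymm hn hle
    refine (MonoJoin.fst_move ha fun x hx => hS x hx b ⟨le_rfl, hb⟩ ?_).trans
      (MonoJoin.snd_move hb fun y hy => hS a' ⟨ha, le_rfl⟩ y hy ?_)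
    · obtain ⟨h1, h2⟩ := mu a x a' le_rfl hx.1 hx.2 le_rfl
      simp only [he, min_self, max_self] at h1 h2
      rw [abs_le]
      constructor <;> linarith [h.1, h.2]
    · obtain ⟨h1, h2⟩ := mv b y b' le_rfl hy.1 hy.2 le_rfl
      have h3 : u a - η ≤ min (v b) (v b') := le_min (by linarith) (by linarith)
      have h4 : max (v b) (v b') ≤ u a + η := max_le (by linarith) (by linarith)
      rw [abs_le]
      constructor <;> linarith
  | succ n ih =>
    intro a b ha hb hu hv mu mv h h' hle hn hS
    rw [abs_le] at h h'
    rcases le_total (u a') (u a + 3 * η) with hc | hc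
    · refine (MonoJoin.fst_move ha fun x hx => hS x hx b ⟨le_rfl, hb⟩ ?_).trans
        (MonoJoin.snd_move hb fun y hy => hS a' ⟨ha, le_rfl⟩ y hy ?_)
      · obtain ⟨h1, h2⟩ := mu a x a' le_rfl hx.1 hx.2 le_rfl
        rw [min_eq_left hle] at h1
        rw [max_eq_right hle] at h2
        rw [abs_le]
        constructor <;> linarith [h.1, h.2]
      · obtain ⟨h1, h2⟩ := mv b y b' le_rfl hy.1 hy.2 le_rfl
        have h3 : u a' - 4 * η ≤ min (v b) (v b') := le_min (by linarith) (by linarith)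
        have h4 : max (v b) (v b') ≤ u a' + η := max_le (by linarith) (by linarith)
        rw [abs_le]
        constructor <;> linarith
    · obtain ⟨p, hp, hup⟩ := intermediate_value_Icc ha hu
        (show u a + η ∈ Icc (u a) (u a') from ⟨by linarith, by linarith⟩)
      obtain ⟨q, hq, hvq⟩ := intermediate_value_Icc hb hv
        (show v b + η ∈ Icc (v b) (v b') from ⟨by linarith, by linarith⟩)
      refine ((MonoJoin.fst_move hp.1 fun x hx =>
          hS x ⟨hx.1, hx.2.trans hp.2⟩ b ⟨le_rfl, hb⟩ ?_).trans
        (MonoJoin.snd_move hq.1 fun y hy => hS p hp y ⟨hy.1, hy.2.trans hq.2⟩ ?_)).trans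
        (ih p q hp.2 hq.2 (hu.mono (Icc_subset_Icc_left hp.1)) (hv.mono (Icc_subset_Icc_left hq.1))
          (fun x y z h1 => mu x y z (hp.1.trans h1)) (fun x y z h1 => mv x y z (hq.1.trans h1))
          ?_ (abs_le.2 h') ?_ ?_
          fun x hx y hy => hS x ⟨hp.1.trans hx.1, hx.2⟩ y ⟨hq.1.trans hy.1, hy.2⟩)
      · obtain ⟨h1, h2⟩ := mu a x p le_rfl hx.1 hx.2 hp.2
        rw [hup, min_eq_left (by linarith)] at h1
        rw [hup, max_eq_right (by linarith)] at h2
        rw [abs_le]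
        constructor <;> linarith
      · obtain ⟨h1, h2⟩ := mv b y q le_rfl hy.1 hy.2 hq.2
        rw [hvq, min_eq_left (by linarith)] at h1
        rw [hvq, max_eq_right (by linarith)] at h2
        rw [abs_le]
        constructor <;> linarith
      · rw [abs_le]
        constructor <;> linarith
      · linarith
      · push_cast at hn
        linarith

lemma NearMonoOn.monoJoin {u v : ℝ → ℝ} {η a a' b b' : ℝ} (hη : 0 < η) {S : Set (ℝ × ℝ)}
    (ha : a ≤ a') (hb : b ≤ b') (hu : ContinuousOn u (Icc a a')) (hv : ContinuousOn v (Icc b b'))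
    (mu : NearMonoOn η u a a') (mv : NearMonoOn η v b b') (h : |u a - v b| ≤ η)
    (h' : |u a' - v b'| ≤ η)
    (hS : ∀ x ∈ Icc a a', ∀ y ∈ Icc b b', |u x - v y| ≤ 5 * η → (x, y) ∈ S) :
    MonoJoin S (a, b) (a', b') := by
  obtain ⟨n, hn⟩ := exists_nat_ge (|u a' - u a| / η)
  rw [div_le_iff₀ hη] at hn
  have hn' := abs_le.1 hn
  rcases le_total (u a) (u a') with hle | hle
  · exact NearMonoOn.monoJoin_of_le hη n a b ha hb hu hv mu mv h h' hle (by linarith) hS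
  · have key : ∀ x y, |-u x - -v y| = |u x - v y| := fun x y => by
      rw [neg_sub_neg, abs_sub_comm]
    exact NearMonoOn.monoJoin_of_le (u := fun x => -u x) (v := fun x => -v x) hη n a b ha hb
      hu.neg hv.neg mu.neg mv.neg
      (by rwa [key]) (by rwa [key]) (neg_le_neg hle) (by linarith)
      fun x hx y hy hxy => hS x hx y hy (by rwa [key] at hxy)

/-- The bound on `dM` from closeness on a grid and small oscillations. -/
lemma dM_le_of_grid {T : ℝ} (hT : 0 < T) {f F L g G K : ℝ → ℝ}
    (hf : IsCadlagExtension T f F L) (hg : IsCadlagExtension T g G K) {δ η c : ℝ} (hη : 0 < η)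
    (hF : OscLE F δ η) (hG : OscLE G δ η) {N : ℕ} (hN : 0 < N) (hNδ : T / N < δ)
    (hNc : T / N ≤ c) (hηc : 5 * η ≤ c)
    (hfg : ∀ i ≤ N, |f (i * (T / N)) - g (i * (T / N))| ≤ η) : dM 0 T f g ≤ c := by
  obtain ⟨r₁, u₁, h₁⟩ := hf.exists_isParamRep hT
  obtain ⟨r₂, u₂, h₂⟩ := hg.exists_isParamRep hT
  have hN0 : (0 : ℝ) < N := Nat.cast_pos.2 hN
  have hm : 0 < T / N := div_pos hT hN0
  have hNT : N * (T / N) = T := by field_simp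
  set S : Set (ℝ × ℝ) := {p | |r₁ p.1 - r₂ p.2| ≤ c ∧ |u₁ p.1 - u₂ p.2| ≤ c} with hS
  have cell : ∀ a b a' b', 0 ≤ a → 0 ≤ b → a' ≤ 1 → b' ≤ 1 → a ≤ a' → b ≤ b' → r₁ a = r₂ b →
      r₁ a' = r₂ b' → r₁ a' - r₁ a ≤ T / N → |u₁ a - u₂ b| ≤ η → |u₁ a' - u₂ b'| ≤ η →
      MonoJoin S (a, b) (a', b') := by
    intro a b a' b' ha hb ha' hb' haa hbb e e' hd hu hu'
    refine NearMonoOn.monoJoin hη haa hbb (h₁.continuousOn_snd.mono (Icc_subset_Icc ha ha'))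
      (h₂.continuousOn_snd.mono (Icc_subset_Icc hb hb')) ?_ ?_ hu hu' ?_
    · intro x y z h1 h2 h3 h4
      have m1 := h₁.monotoneOn ⟨ha, by linarith⟩ ⟨by linarith, by linarith⟩ h1
      have m2 := h₁.monotoneOn ⟨by linarith, by linarith⟩ ⟨by linarith, ha'⟩ h4
      exact h₁.nearHull hf hη.le hF (ha.trans h1) h2 h3 (h4.trans ha') (by linarith)
    · intro x y z h1 h2 h3 h4
      have m1 := h₂.monotoneOn ⟨hb, by linarith⟩ ⟨by linarith, by linarith⟩ h1
      have m2 := h₂.monotoneOn ⟨by linarith, by linarith⟩ ⟨by linarith, hb'⟩ h4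
      exact h₂.nearHull hg hη.le hG (hb.trans h1) h2 h3 (h4.trans hb') (by linarith)
    · intro x hx y hy hxy
      have m1 := h₁.monotoneOn ⟨ha, by linarith⟩ ⟨by linarith [hx.1], by linarith [hx.2]⟩ hx.1
      have m2 := h₁.monotoneOn ⟨by linarith [hx.1], by linarith [hx.2]⟩ ⟨by linarith, ha'⟩ hx.2
      have m3 := h₂.monotoneOn ⟨hb, by linarith⟩ ⟨by linarith [hy.1], by linarith [hy.2]⟩ hy.1
      have m4 := h₂.monotoneOn ⟨by linarith [hy.1], by linarith [hy.2]⟩ ⟨by linarith, hb'⟩ hy.2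
      exact ⟨abs_le.2 ⟨by linarith, by linarith⟩, hxy.trans hηc⟩
  have grid : ∀ i ≤ N, ∃ a ∈ Icc (0 : ℝ) 1, ∃ b ∈ Icc (0 : ℝ) 1, r₁ a = i * (T / N) ∧
      r₂ b = i * (T / N) ∧ |u₁ a - u₂ b| ≤ η ∧ MonoJoin S (0, 0) (a, b) := by
    intro i
    induction i with
    | zero =>
      intro _
      have h0 := hfg 0 hN.le
      rw [Nat.cast_zero, zero_mul] at h0
      have hu : |u₁ 0 - u₂ 0| ≤ η := by rwa [h₁.init.2, h₂.init.2]
      refine ⟨0, ⟨le_rfl, zero_le_one⟩, 0, ⟨le_rfl, zero_le_one⟩, by simp [h₁.init.1],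
        by simp [h₂.init.1], hu, ?_⟩
      exact cell 0 0 0 0 le_rfl le_rfl zero_le_one zero_le_one le_rfl le_rfl
        (by rw [h₁.init.1, h₂.init.1]) (by rw [h₁.init.1, h₂.init.1]) (by simpa using hm.le) hu hu
    | succ i ih =>
      intro hi
      obtain ⟨a, ha, b, hb, ea, eb, hu, hj⟩ := ih (by omega)
      have hiN : ((i + 1 : ℕ) : ℝ) * (T / N) ∈ Icc 0 T := by
        refine ⟨by positivity, ?_⟩
        calc ((i + 1 : ℕ) : ℝ) * (T / N) ≤ N * (T / N) :=
              mul_le_mul_of_nonneg_right (Nat.cast_le.2 hi) hm.le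
          _ = T := hNT
      obtain ⟨a', ha', ea', ua'⟩ := h₁.exists_eq hiN
      obtain ⟨b', hb', eb', ub'⟩ := h₂.exists_eq hiN
      have hu' : |u₁ a' - u₂ b'| ≤ η := by rw [ua', ub']; exact hfg _ hi
      have hstep : ((i + 1 : ℕ) : ℝ) * (T / N) = i * (T / N) + T / N := by push_cast; ring
      have haa : a ≤ a' := by
        by_contra! hlt
        linarith [h₁.monotoneOn ha' ha hlt.le]
      have hbb : b ≤ b' := by
        by_contra! hlt
        linarith [h₂.monotoneOn hb' hb hlt.le]
      exact ⟨a', ha', b', hb', ea', eb', hu', hj.trans (cell a b a' b' ha.1 hb.1 ha'.2 hb'.2 haa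
        hbb (ea.trans eb.symm) (ea'.trans eb'.symm) (by linarith) hu hu')⟩
  obtain ⟨a, ha, b, hb, ea, eb, hu, hj⟩ := grid N le_rfl
  rw [hNT] at ea eb
  have h1 := hfg N le_rfl
  rw [hNT] at h1
  obtain ⟨α, β, hα, hβ, mα, mβ, e0, e1, hαβ⟩ := hj.trans (cell a b 1 1 ha.1 hb.1 le_rfl le_rfl
    ha.2 hb.2 (ea.trans eb.symm) (by rw [h₁.last.1, h₂.last.1])
    (by rw [ea, h₁.last.1, sub_self]; exact hm.le) hu (by rwa [h₁.last.2, h₂.last.2]))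
  rw [Prod.mk.injEq] at e0 e1
  exact dM_le_of_isParamRep
    (h₁.comp hα.continuousOn (mα.monotoneOn _) e0.1 e1.1)
    (h₂.comp hβ.continuousOn (mβ.monotoneOn _) e0.2 e1.2)
    (fun s hs => (hαβ s hs).1) (fun s hs => (hαβ s hs).2)

section Processes

open MeasureTheory
open scoped ENNReal

/-- A stochastically continuous real process on `[0, T]` with càdlàg trajectories. -/
structure IsCadlagProcess {Ω : Type*} [MeasurableSpace Ω] (P : Measure Ω) (T : ℝ)
    (x : ℝ → Ω → ℝ) : Prop where
  measurable : ∀ t ∈ Icc 0 T, Measurable (x t)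
  cadlag : ∀ ω, IsCadlagOn (fun t => x t ω) 0 T
  stochCont : ∀ t ∈ Icc 0 T, ∀ ε > (0 : ℝ),
    Tendsto (fun s => P {ω | ε ≤ |x s ω - x t ω|}) (𝓝[Icc 0 T] t) (𝓝 0)

namespace IsCadlagProcess

variable {Ω : Type*} [MeasurableSpace Ω] {P : Measure Ω} {T : ℝ} {x : ℝ → Ω → ℝ}

lemma clm_comp {V : Type*} [NormedAddCommGroup V] [NormedSpace ℝ V] [MeasurableSpace V]
    [BorelSpace V] {X : ℝ → Ω → V} (hmeas : ∀ t ∈ Icc (0 : ℝ) T, Measurable (X t))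
    (hcad : ∀ ω, IsCadlagOn (fun t => X t ω) 0 T)
    (hsc : ∀ t ∈ Icc (0 : ℝ) T, ∀ ε > (0 : ℝ),
      Tendsto (fun s => P {ω | ε ≤ ‖X s ω - X t ω‖}) (𝓝[Icc 0 T] t) (𝓝 0))
    (vs : V →L[ℝ] ℝ) : IsCadlagProcess P T fun t ω => vs (X t ω) := by
  refine ⟨fun t ht => vs.continuous.measurable.comp (hmeas t ht), fun ω => ⟨fun t ht => ?_,
    fun t ht => ?_⟩, fun t ht ε hε => ?_⟩
  · exact (vs.continuous.tendsto _).comp ((hcad ω).1 t ht)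
  · obtain ⟨l, hl⟩ := (hcad ω).2 t ht
    exact ⟨vs l, (vs.continuous.tendsto _).comp hl⟩
  · have hpos : 0 < ‖vs‖ + 1 := by positivity
    refine tendsto_of_tendsto_of_tendsto_of_le_of_le tendsto_const_nhds
      (hsc t ht (ε / (‖vs‖ + 1)) (div_pos hε hpos)) (fun _ => zero_le)
      fun s => measure_mono fun ω hω => ?_
    have h1 : |vs (X s ω) - vs (X t ω)| ≤ ‖vs‖ * ‖X s ω - X t ω‖ := by
      rw [← map_sub, ← Real.norm_eq_abs]
      exact vs.le_opNorm _
    simp only [mem_ofPred_eq] at hω ⊢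
    rw [div_le_iff₀ hpos]
    nlinarith [norm_nonneg (X s ω - X t ω)]

variable (hx : IsCadlagProcess P T x) (hT : 0 < T)
include hx hT

lemma measurable_clamp (t : ℝ) : Measurable (x (max 0 (min t T))) :=
  hx.measurable _ ⟨le_max_left _ _, max_le hT.le (min_le_right _ _)⟩

lemma tendsto_oscLE [IsFiniteMeasure P] {ε : ℝ} (hε : 0 < ε) :
    Tendsto (fun δ => P {ω | ¬ OscLE (fun t => x (max 0 (min t T)) ω) δ ε}) (𝓝[>] 0) (𝓝 0) := by
  set F : ℝ → Ω → ℝ := fun t => x (max 0 (min t T)) with hF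
  have hFm : ∀ t, Measurable (F t) := hx.measurable_clamp hT
  set A : ℕ → Set Ω := fun k => {ω | ∃ a b c : ℚ, (c : ℝ) - a < 1 / ((k : ℝ) + 1) ∧ a < b ∧
    b < c ∧ ¬ NearHull ε (F a ω) (F b ω) (F c ω)} with hA
  have hAm : ∀ k, MeasurableSet (A k) := by
    intro k
    simp only [hA, ofPred_exists, ofPred_and]
    refine MeasurableSet.iUnion fun a => MeasurableSet.iUnion fun b => MeasurableSet.iUnion
      fun c => (MeasurableSet.const _).inter ((MeasurableSet.const _).inter
        ((MeasurableSet.const _).inter (MeasurableSet.compl ?_)))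
    exact (measurableSet_le (((hFm a).min (hFm c)).sub_const _) (hFm b)).inter
      (measurableSet_le (hFm b) (((hFm a).max (hFm c)).add_const _))
  have hAa : Antitone A := by
    rintro k l hkl ω ⟨a, b, c, h1, h2⟩
    exact ⟨a, b, c, h1.trans_le (Nat.one_div_le_one_div hkl), h2⟩
  have hA0 : ⋂ k, A k = ∅ := by
    refine eq_empty_of_forall_notMem fun ω hω => ?_
    obtain ⟨L, hL⟩ := (hx.cadlag ω).exists_extension hT
    obtain ⟨δ, hδ, hosc⟩ := hL.exists_oscLE hT hε
    obtain ⟨k, hk⟩ := exists_nat_one_div_lt hδ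
    obtain ⟨a, b, c, h1, h2, h3, h4⟩ := mem_iInter.1 hω k
    exact h4 (hosc a b c (Rat.cast_lt.2 h2).le (Rat.cast_lt.2 h3).le (h1.trans hk))
  have hlim : Tendsto (fun k => P (A k)) atTop (𝓝 0) := by
    have := tendsto_measure_iInter_atTop (μ := P) (fun k => (hAm k).nullMeasurableSet) hAa
      ⟨0, measure_ne_top _ _⟩
    rwa [hA0, measure_empty] at this
  rw [ENNReal.tendsto_nhds_zero] at hlim ⊢
  intro θ hθ
  obtain ⟨k, hk⟩ := (hlim θ hθ).exists
  filter_upwards [Ioo_mem_nhdsGT (show (0 : ℝ) < 1 / ((k : ℝ) + 1) from Nat.one_div_pos_of_nat)]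
    with δ hδ
  refine (measure_mono fun ω hω => ?_).trans hk
  by_contra hωA
  obtain ⟨L, hL⟩ := (hx.cadlag ω).exists_extension hT
  refine hω (hL.cadlag.oscLE_of_rat hε.le fun a b c h1 h2 h3 => ?_)
  by_contra h4
  exact hωA ⟨a, b, c, h1.trans hδ.2, h2, h3, h4⟩

lemma measure_jump_eq_zero {t ε : ℝ} (ht : t ∈ Icc 0 T) (hε : 0 < ε) :
    P {ω | ∀ k : ℕ, ∃ q : ℚ, |(q : ℝ) - t| < 1 / ((k : ℝ) + 1) ∧
      ε < |x (max 0 (min (q : ℝ) T)) ω - x t ω|} = 0 := by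
  set s : ℕ → ℝ := fun j => max 0 (min (t - 1 / ((j : ℝ) + 1)) T) with hs
  have hsub : {ω | ∀ k : ℕ, ∃ q : ℚ, |(q : ℝ) - t| < 1 / ((k : ℝ) + 1) ∧
      ε < |x (max 0 (min (q : ℝ) T)) ω - x t ω|} ⊆
      ⋃ k : ℕ, {ω | ∀ j ≥ k, ε / 2 ≤ |x (s j) ω - x t ω|} := by
    intro ω hω
    obtain ⟨L, hL⟩ := (hx.cadlag ω).exists_extension hT
    obtain ⟨a, ha, hLa⟩ := hL.cadlag.near_left t (show 0 < ε / 4 by linarith)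
    obtain ⟨b, hb, hRb⟩ := hL.cadlag.near_right t hε
    rw [hL.eqOn t ht] at hRb
    obtain ⟨k, hk⟩ := exists_nat_one_div_lt (lt_min (sub_pos.2 ha) (sub_pos.2 hb))
    obtain ⟨q, hq, hqε⟩ := hω k
    obtain ⟨hka, hkb⟩ := lt_min_iff.1 hk
    obtain ⟨hq1, hq2⟩ := abs_lt.1 hq
    have hqt : (q : ℝ) < t := by
      by_contra! hlt
      rcases hlt.eq_or_lt with e | hlt
      · have h0 := hL.eqOn t ht
        rw [← e, h0, sub_self, abs_zero] at hqε
        linarith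
      · obtain ⟨h1, h2⟩ := (hRb q ⟨hlt, by linarith⟩).1
        exact absurd (abs_le.2 ⟨by linarith, by linarith⟩) hqε.not_ge
    obtain ⟨h1, h2⟩ := (hLa q ⟨by linarith, hqt⟩).1
    refine mem_iUnion.2 ⟨k, fun j hj => ?_⟩
    have hj0 : (0 : ℝ) < 1 / ((j : ℝ) + 1) := Nat.one_div_pos_of_nat
    have hjk : 1 / ((j : ℝ) + 1) ≤ 1 / ((k : ℝ) + 1) := Nat.one_div_le_one_div hj
    obtain ⟨h3, h4⟩ := (hLa (t - 1 / ((j : ℝ) + 1)) ⟨by linarith, by linarith⟩).1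
    rcases lt_abs.1 hqε with h | h
    · exact le_abs.2 (Or.inl (by simp only [hs]; linarith))
    · exact le_abs.2 (Or.inr (by simp only [hs]; linarith))
  refine measure_mono_null hsub (measure_iUnion_null fun k => ?_)
  have hst : Tendsto s atTop (𝓝[Icc 0 T] t) := by
    refine tendsto_nhdsWithin_iff.2 ⟨?_, Eventually.of_forall fun j =>
      ⟨le_max_left _ _, max_le hT.le (min_le_right _ _)⟩⟩
    have hc : Continuous fun y : ℝ => max 0 (min (t - y) T) := by fun_prop
    have := (hc.tendsto 0).comp tendsto_one_div_add_atTop_nhds_zero_nat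
    simpa [Function.comp_def, hs, ht.1, ht.2] using this
  refine le_antisymm (ge_of_tendsto ((hx.stochCont t ht (ε / 2) (half_pos hε)).comp hst) ?_)
    zero_le
  filter_upwards [eventually_ge_atTop k] with j hj
  exact measure_mono fun ω hω => hω j hj

lemma exists_measure_rat_le [IsFiniteMeasure P] {t ε : ℝ} (ht : t ∈ Icc 0 T) (hε : 0 < ε)
    {θ : ℝ≥0∞} (hθ : 0 < θ) : ∃ ρ > (0 : ℝ), P {ω | ∃ q : ℚ, |(q : ℝ) - t| < ρ ∧
      ε < |x (max 0 (min (q : ℝ) T)) ω - x t ω|} ≤ θ := by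
  set C : ℕ → Set Ω := fun k => {ω | ∃ q : ℚ, |(q : ℝ) - t| < 1 / ((k : ℝ) + 1) ∧
      ε < |x (max 0 (min (q : ℝ) T)) ω - x t ω|} with hC
  have hCm : ∀ k, MeasurableSet (C k) := by
    intro k
    simp only [hC, ofPred_exists, ofPred_and]
    refine MeasurableSet.iUnion fun q => (MeasurableSet.const _).inter ?_
    exact measurableSet_lt measurable_const
      (continuous_abs.measurable.comp ((hx.measurable_clamp hT q).sub (hx.measurable t ht)))
  have hCa : Antitone C := by
    rintro k l hkl ω ⟨q, h1, h2⟩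
    exact ⟨q, h1.trans_le (Nat.one_div_le_one_div hkl), h2⟩
  have hlim := tendsto_measure_iInter_atTop (μ := P) (fun k => (hCm k).nullMeasurableSet) hCa
    ⟨0, measure_ne_top _ _⟩
  rw [show ⋂ k, C k = _ from (ofPred_forall _).symm, hx.measure_jump_eq_zero hT ht hε,
    ENNReal.tendsto_nhds_zero] at hlim
  obtain ⟨k, hk⟩ := (hlim θ hθ).exists
  exact ⟨_, Nat.one_div_pos_of_nat, hk⟩

end IsCadlagProcess

section Convergence

variable {Ω : Type*} [MeasurableSpace Ω] {P : Measure Ω} [IsFiniteMeasure P] {T : ℝ}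
  {x : ℝ → Ω → ℝ} {xn : ℕ → ℝ → Ω → ℝ}

lemma tendsto_measure_eval_of_dM (hT : 0 < T) (hx : IsCadlagProcess P T x)
    (hxn : ∀ n ω, IsCadlagOn (fun t => xn n t ω) 0 T)
    (h : ∀ ε > (0 : ℝ), Tendsto
      (fun n => P {ω | ε ≤ dM 0 T (fun t => xn n t ω) (fun t => x t ω)}) atTop (𝓝 0))
    {t : ℝ} (ht : t ∈ Icc 0 T) {ε : ℝ} (hε : 0 < ε) :
    Tendsto (fun n => P {ω | ε ≤ |xn n t ω - x t ω|}) atTop (𝓝 0) := by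
  rw [ENNReal.tendsto_nhds_zero]
  intro θ hθ
  obtain ⟨ρ, hρ, hPρ⟩ := hx.exists_measure_rat_le hT ht (show 0 < ε / 4 by linarith)
    (ENNReal.half_pos hθ.ne')
  set η := min (ρ / 2) (ε / 4) with hη
  have hη0 : 0 < η := lt_min (by linarith) (by linarith)
  filter_upwards [ENNReal.tendsto_nhds_zero.1 (h η hη0) (θ / 2) (ENNReal.half_pos hθ.ne')]
    with n hn
  rw [← ENNReal.add_halves θ]
  refine (measure_mono fun ω hω => ?_).trans ((measure_union_le _ _).trans (add_le_add hn hPρ))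
  by_contra hnot
  simp only [mem_union, mem_ofPred_eq, not_or, not_le, not_exists, not_and, not_lt] at hnot hω
  obtain ⟨L, hL⟩ := (hx.cadlag ω).exists_extension hT
  obtain ⟨K, hK⟩ := (hxn n ω).exists_extension hT
  have := abs_sub_le_of_dM_lt hT hK hL ht hnot.1
    (show η < ρ by linarith [min_le_left (ρ / 2) (ε / 4)]) (fun q hq => by
      rw [hL.eqOn t ht]
      exact hnot.2 q hq)
  linarith [min_le_right (ρ / 2) (ε / 4)]

lemma tendsto_limsup_measure_oscM_of_dM (hT : 0 < T) (hx : IsCadlagProcess P T x)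
    (hxn : ∀ n ω, IsCadlagOn (fun t => xn n t ω) 0 T)
    (h : ∀ ε > (0 : ℝ), Tendsto
      (fun n => P {ω | ε ≤ dM 0 T (fun t => xn n t ω) (fun t => x t ω)}) atTop (𝓝 0))
    {ε : ℝ} (hε : 0 < ε) :
    Tendsto (fun δ : ℝ => limsup (fun n => P {ω | ε ≤ oscM (fun t => xn n t ω) 0 T δ}) atTop)
      (𝓝[>] 0) (𝓝 0) := by
  have h4 : Tendsto (fun δ : ℝ => 4 * δ) (𝓝[>] 0) (𝓝[>] 0) := by
    refine tendsto_nhdsWithin_iff.2 ⟨?_, ?_⟩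
    · have hc : Continuous fun δ : ℝ => 4 * δ := by fun_prop
      simpa using (hc.tendsto 0).mono_left nhdsWithin_le_nhds
    · filter_upwards [self_mem_nhdsWithin] with δ hδ
      exact mul_pos four_pos (mem_Ioi.1 hδ)
  refine tendsto_of_tendsto_of_tendsto_of_le_of_le' tendsto_const_nhds
    ((hx.tendsto_oscLE hT (show 0 < ε / 4 by linarith)).comp h4)
    (Eventually.of_forall fun _ => zero_le) ?_
  filter_upwards [self_mem_nhdsWithin] with δ hδ
  rw [mem_Ioi] at hδ
  set η := min δ (ε / 8) with hη
  have hη0 : 0 < η := lt_min hδ (by linarith)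
  have hlim := (h η hη0).add_const
    (P {ω | ¬ OscLE (fun t => x (max 0 (min t T)) ω) (4 * δ) (ε / 4)})
  rw [zero_add] at hlim
  refine (limsup_le_limsup (Eventually.of_forall fun n => ?_)).trans hlim.limsup_eq.le
  refine (measure_mono fun ω hω => ?_).trans (measure_union_le _ _)
  by_contra hnot
  simp only [mem_union, mem_ofPred_eq, not_or, not_le, not_not] at hnot hω
  obtain ⟨L, hL⟩ := (hx.cadlag ω).exists_extension hT
  obtain ⟨K, hK⟩ := (hxn n ω).exists_extension hT
  have := oscM_le_of_dM_lt hT hK hL (by linarith) hη0.le hnot.1 hnot.2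
    (show δ + 2 * η < 4 * δ by linarith [min_le_left δ (ε / 8)])
  linarith [min_le_right δ (ε / 8)]

lemma tendsto_measure_dM (hT : 0 < T) (hx : IsCadlagProcess P T x)
    (hxn : ∀ n ω, IsCadlagOn (fun t => xn n t ω) 0 T)
    (hfdd : ∀ t ∈ Icc 0 T, ∀ ε > (0 : ℝ),
      Tendsto (fun n => P {ω | ε ≤ |xn n t ω - x t ω|}) atTop (𝓝 0))
    (hosc : ∀ ε > (0 : ℝ), Tendsto
      (fun δ : ℝ => limsup (fun n => P {ω | ε ≤ oscM (fun t => xn n t ω) 0 T δ}) atTop)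
      (𝓝[>] 0) (𝓝 0)) {ε : ℝ} (hε : 0 < ε) :
    Tendsto (fun n => P {ω | ε ≤ dM 0 T (fun t => xn n t ω) (fun t => x t ω)})
      atTop (𝓝 0) := by
  rw [ENNReal.tendsto_nhds_zero]
  intro θ hθ
  have hθ3 : 0 < θ / 3 := ENNReal.div_pos hθ.ne' (by norm_num)
  set η := ε / 10 with hη
  have hη0 : 0 < η := by positivity
  obtain ⟨δ, ⟨h1, h2⟩, hδ⟩ := ((((tendsto_order.1 (hosc η hη0)).2 _ hθ3).and
    (ENNReal.tendsto_nhds_zero.1 (hx.tendsto_oscLE hT hη0) _ hθ3)).and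
      self_mem_nhdsWithin).exists
  obtain ⟨N, hN⟩ := exists_nat_gt (T / min δ (ε / 2))
  have hmin : 0 < min δ (ε / 2) := lt_min hδ (half_pos hε)
  have hN0 : (0 : ℝ) < N := (div_pos hT hmin).trans hN
  rw [div_lt_comm₀ hmin hN0, lt_min_iff] at hN
  have hsum : Tendsto (fun n => ∑ i ∈ Finset.range (N + 1),
      P {ω | η ≤ |xn n (i * (T / N)) ω - x (i * (T / N)) ω|}) atTop (𝓝 0) := by
    have := tendsto_finsetSum (Finset.range (N + 1)) fun i hi =>
      hfdd (i * (T / N)) ⟨by positivity, by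
        calc (i : ℝ) * (T / N) ≤ N * (T / N) := mul_le_mul_of_nonneg_right
              (Nat.cast_le.2 (Nat.lt_succ_iff.1 (Finset.mem_range.1 hi))) (by positivity)
          _ = T := by field_simp⟩ η hη0
    simpa using this
  filter_upwards [eventually_lt_of_limsup_lt h1, ENNReal.tendsto_nhds_zero.1 hsum _ hθ3]
    with n hn1 hn2
  rw [← ENNReal.add_thirds θ]
  refine (measure_mono fun ω hω => ?_).trans ((measure_union_le _ _).trans (add_le_add
    ((measure_union_le _ _).trans (add_le_add hn1.le h2))
    ((measure_biUnion_finset_le _ _).trans hn2)))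
  by_contra hnot
  simp only [mem_union, mem_ofPred_eq, not_or, not_le, not_not, mem_iUnion, not_exists,
    Finset.mem_range, Nat.lt_succ_iff] at hnot hω
  obtain ⟨⟨hn, hn'⟩, hgrid⟩ := hnot
  obtain ⟨L, hL⟩ := (hx.cadlag ω).exists_extension hT
  obtain ⟨K, hK⟩ := (hxn n ω).exists_extension hT
  have := dM_le_of_grid hT hK hL hη0 (hK.oscLE_of_oscM_le hT hη0.le hn.le) hn'
    (Nat.cast_pos.1 hN0) hN.1 hN.2.le (show 5 * η ≤ ε / 2 by rw [hη]; linarith)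
    fun i hi => (hgrid i hi).le
  linarith

end Convergence

end Processes

end RealPaths

open MeasureTheory in
/-- for a separable real Banach space `V` and stochastically continuous
processes `X`, `Xₙ` with càdlàg trajectories, weak `M₁` convergence in probability
(i.e. `d_M(⟨Xₙ,v*⟩, ⟨X,v*⟩) → 0` in probability for every `v* ∈ V*`) is equivalent to,
for every `v* ∈ V*`: (i) `⟨Xₙ(t), v*⟩ → ⟨X(t), v*⟩` in probability for each `t`, and
(ii) `lim_{δ↘0} limsup_n P(M(⟨Xₙ, v*⟩; δ) ≥ ε) = 0` for every `ε > 0`. -/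
theorem weak_stochconv_iff_fdd_and_oscillation {V : Type*} [NormedAddCommGroup V]
    [NormedSpace ℝ V] [CompleteSpace V] [TopologicalSpace.SeparableSpace V]
    [MeasurableSpace V] [BorelSpace V]
    {Ω : Type*} [MeasurableSpace Ω] (P : Measure Ω) [IsProbabilityMeasure P]
    (T : ℝ) (hT : 0 < T) (X : ℝ → Ω → V) (Xn : ℕ → ℝ → Ω → V)
    (hmeas : ∀ t ∈ Set.Icc (0:ℝ) T, Measurable (X t))
    (hmeasn : ∀ n, ∀ t ∈ Set.Icc (0:ℝ) T, Measurable (Xn n t))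
    (hcad : ∀ ω, IsCadlagOn (fun t => X t ω) 0 T)
    (hcadn : ∀ n ω, IsCadlagOn (fun t => Xn n t ω) 0 T)
    (hsc : ∀ t ∈ Set.Icc (0:ℝ) T, ∀ ε > (0:ℝ),
      Filter.Tendsto (fun s => P {ω | ε ≤ ‖X s ω - X t ω‖})
        (nhdsWithin t (Set.Icc 0 T)) (nhds 0))
    (hscn : ∀ n, ∀ t ∈ Set.Icc (0:ℝ) T, ∀ ε > (0:ℝ),
      Filter.Tendsto (fun s => P {ω | ε ≤ ‖Xn n s ω - Xn n t ω‖})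
        (nhdsWithin t (Set.Icc 0 T)) (nhds 0)) :
    (∀ vs : V →L[ℝ] ℝ, ∀ ε > (0:ℝ), Filter.Tendsto
        (fun n => P {ω | ε ≤ dM 0 T (fun t => vs (Xn n t ω)) (fun t => vs (X t ω))})
        Filter.atTop (nhds 0))
    ↔
    (∀ vs : V →L[ℝ] ℝ,
      (∀ t ∈ Set.Icc (0:ℝ) T, ∀ ε > (0:ℝ), Filter.Tendsto
        (fun n => P {ω | ε ≤ |vs (Xn n t ω) - vs (X t ω)|}) Filter.atTop (nhds 0)) ∧
      (∀ ε > (0:ℝ), Filter.Tendsto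
        (fun δ : ℝ => Filter.limsup
          (fun n => P {ω | ε ≤ oscM (fun t => vs (Xn n t ω)) 0 T δ}) Filter.atTop)
        (nhdsWithin 0 (Set.Ioi 0)) (nhds 0))) := by
  have hx : ∀ vs : V →L[ℝ] ℝ, IsCadlagProcess P T fun t ω => vs (X t ω) :=
    IsCadlagProcess.clm_comp hmeas hcad hsc
  have hxn : ∀ (vs : V →L[ℝ] ℝ) n ω, IsCadlagOn (fun t => vs (Xn n t ω)) 0 T := fun vs n =>
    (IsCadlagProcess.clm_comp (hmeasn n) (hcadn n) (hscn n) vs).cadlag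
  refine forall_congr' fun vs => ⟨fun h => ⟨fun t ht ε hε => ?_, fun ε hε => ?_⟩, fun h ε hε => ?_⟩
  · exact tendsto_measure_eval_of_dM hT (hx vs) (xn := fun n t ω => vs (Xn n t ω)) (hxn vs) h ht hε
  · exact tendsto_limsup_measure_oscM_of_dM hT (hx vs) (xn := fun n t ω => vs (Xn n t ω))
      (hxn vs) h hε
  · exact tendsto_measure_dM hT (hx vs) (xn := fun n t ω => vs (Xn n t ω)) (hxn vs) h.1 h.2 hε
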